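/- arXiv:2306.16091 — 3 statements merged into one kernel-verified Lean document; each statement's English description precedes it below -/
import Mathlib

section
/- Let H : [0,1] → (0,1) be Lipschitz continuous with 0 < H̲ ≤ H_t ≤ H̄ < 1 for all t, and let C(s,t) = D(H_s, H_t)·[ s^{H_s+H_t} + t^{H_s+H_t} − |t − s|^{H_s+H_t} ] be the covariance function of the multifractional Brownian motion with Hurst function H, where D(x,y) = √(Γ(2x+1)·Γ(2y+1)·sin(πx)·sin(πy)) / ( 2·Γ(x+y+1)·sin(π(x+y)/2) ). Define the increment-variance function θ(u,v) = C(u,u) + C(v,v) − 2C(u,v). Then there exist constants Δ₀ > 0, S ≥ 0 and β > 0 such that for all u ≤ t ≤ v in [0,1] with |u − v| ≤ Δ₀: | θ(u,v) − |u − v|^{2H_t} | ≤ S·|u − v|^{2H_t + 2β}. In other words, the multifractional Brownian motion satisfies the local regularity condition (H2) with exponent function H and local Hölder constant L ≡ 1. -/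
open Set

/-- The normalizing constant `D(x,y)` in the covariance of the multifractional
Brownian motion. -/
noncomputable def Dnorm (x y : ℝ) : ℝ :=
  Real.sqrt (Real.Gamma (2 * x + 1) * Real.Gamma (2 * y + 1) *
      Real.sin (Real.pi * x) * Real.sin (Real.pi * y)) /
    (2 * Real.Gamma (x + y + 1) * Real.sin (Real.pi * (x + y) / 2))

/-- The covariance function of the multifractional Brownian motion with Hurst
exponent function `H`. -/
noncomputable def mfbmCov (H : ℝ → ℝ) (s t : ℝ) : ℝ :=
  Dnorm (H s) (H t) *
    (s ^ (H s + H t) + t ^ (H s + H t) - |t - s| ^ (H s + H t))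

lemma rpow_diff_log {x a b : ℝ} (hx : 0 < x) (hx1 : x ≤ 1) :
    |x ^ a - x ^ b| ≤ |a - b| * |Real.log x| * x ^ (min a b) := by
  wlog hab : a ≤ b generalizing a b
  · have := this (a := b) (b := a) (by linarith)
    rwa [abs_sub_comm, abs_sub_comm b a, min_comm] at this
  rw [min_eq_left hab]
  have h1 : x ^ b = x ^ a * x ^ (b - a) := by rw [← Real.rpow_add hx]; ring_nf
  have h2 : x ^ (b - a) ≤ 1 := Real.rpow_le_one hx.le hx1 (by linarith)
  have h3 : 1 + Real.log x * (b - a) ≤ x ^ (b - a) := by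
    rw [Real.rpow_def_of_pos hx]; linarith [Real.add_one_le_exp (Real.log x * (b - a))]
  have h4 := Real.log_nonpos hx.le hx1
  have h5 : 0 < x ^ a := Real.rpow_pos_of_pos hx a
  rw [h1, abs_of_nonneg (by nlinarith), abs_of_nonpos h4, abs_of_nonpos (by linarith : a - b ≤ 0)]
  have := mul_le_mul_of_nonneg_left h3 h5.le
  nlinarith

lemma rpow_diff_exp {x a b c : ℝ} (hx : 0 ≤ x) (hx1 : x ≤ 1) (hc : 0 < c) (ha : c ≤ a)
    (hb : c ≤ b) : |x ^ a - x ^ b| ≤ |a - b| / c := by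
  rcases hx.eq_or_lt with rfl | hx
  · rw [Real.zero_rpow (by linarith), Real.zero_rpow (by linarith)]
    simp; positivity
  refine (rpow_diff_log hx hx1).trans ?_
  have h1 : x ^ (min a b) ≤ x ^ c := Real.rpow_le_rpow_of_exponent_ge hx hx1 (le_min ha hb)
  have h2 := (Real.abs_log_mul_self_rpow_lt x c hx hx1 hc).le
  rw [abs_mul, abs_of_pos (Real.rpow_pos_of_pos hx c)] at h2
  calc _ ≤ |a - b| * |Real.log x| * x ^ c := by gcongr
    _ = |a - b| * (|Real.log x| * x ^ c) := by ring
    _ ≤ |a - b| * (1 / c) := by gcongr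
    _ = _ := by ring

lemma rpow_sub_le {u v a : ℝ} (hu : 0 ≤ u) (huv : u ≤ v) (ha : 0 ≤ a) (ha1 : a ≤ 1) :
    v ^ a - u ^ a ≤ (v - u) ^ a := by
  have := Real.rpow_add_le_add_rpow hu (sub_nonneg.2 huv) ha ha1
  rw [add_sub_cancel] at this
  linarith

lemma second_diff {u v a b : ℝ} (hu : 0 ≤ u) (huv : u < v) (hv : v ≤ 1) (ha : 0 < a)
    (ha1 : a ≤ 1) (hab : a ≤ b) :
    |(u ^ a - u ^ b) - (v ^ a - v ^ b)| ≤
      (b - a) * ((v - u) ^ a * (|Real.log (v - u)| + 1 / a)) := by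
  have hv0 : 0 < v := by linarith
  have hh : 0 < v - u := by linarith
  have hvb : v ^ b = v ^ a * v ^ (b - a) := by rw [← Real.rpow_add hv0]; ring_nf
  have hA : 0 ≤ v ^ a - u ^ a := sub_nonneg.2 (Real.rpow_le_rpow hu huv.le ha.le)
  have hA' := rpow_sub_le hu huv.le ha.le ha1
  have h1 : 0 ≤ 1 - v ^ (b - a) := sub_nonneg.2 (Real.rpow_le_one hv0.le hv (by linarith))
  have h3 : 1 - v ^ (b - a) ≤ (b - a) * |Real.log (v - u)| := by
    have e1 : 1 + Real.log v * (b - a) ≤ v ^ (b - a) := by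
      rw [Real.rpow_def_of_pos hv0]; linarith [Real.add_one_le_exp (Real.log v * (b - a))]
    have e2 : Real.log (v - u) ≤ Real.log v := Real.log_le_log hh (by linarith)
    have e3 := neg_abs_le (Real.log (v - u))
    nlinarith
  have hp := Real.rpow_pos_of_pos hh a
  have h4 : 0 ≤ u ^ a * v ^ (b - a) - u ^ b ∧
      u ^ a * v ^ (b - a) - u ^ b ≤ (b - a) * ((v - u) ^ a * (1 / a)) := by
    rcases hu.eq_or_lt with rfl | hu
    · rw [Real.zero_rpow (by linarith), Real.zero_rpow (by linarith)]
      simp only [zero_mul, sub_zero, le_refl, true_and]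
      have : 0 ≤ b - a := by linarith
      positivity
    have hub : u ^ b = u ^ a * u ^ (b - a) := by rw [← Real.rpow_add hu]; ring_nf
    have hua := Real.rpow_pos_of_pos hu a
    rw [hub]
    have hd : u ^ (b - a) ≤ v ^ (b - a) := Real.rpow_le_rpow hu.le huv.le (by linarith)
    refine ⟨by nlinarith, ?_⟩
    -- logarithmic bound
    have e1 : Real.log (v / u) ≤ ((v - u) / u) ^ a / a := by
      have z0 : 0 < (v - u) / u := by positivity
      have z1 : v / u = 1 + (v - u) / u := by field_simp; ring
      have z2 := Real.rpow_add_le_add_rpow zero_le_one z0.le ha.le ha1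
      rw [Real.one_rpow] at z2
      have z3 : 0 < (v / u) ^ a := by positivity
      have z4 := Real.log_le_sub_one_of_pos z3
      rw [Real.log_rpow (by positivity)] at z4
      rw [le_div_iff₀ ha]
      rw [← z1] at z2
      linarith
    have e2 : v ^ (b - a) - u ^ (b - a) ≤ (b - a) * Real.log (v / u) := by
      have y1 : u ^ (b - a) = v ^ (b - a) * (u / v) ^ (b - a) := by
        rw [← Real.mul_rpow hv0.le (by positivity)]; congr 1; field_simp
      have y2 : 1 - (b - a) * Real.log (v / u) ≤ (u / v) ^ (b - a) := by
        rw [Real.rpow_def_of_pos (by positivity)]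
        have : Real.log (u / v) = - Real.log (v / u) := by rw [← Real.log_inv, inv_div]
        have := Real.add_one_le_exp (Real.log (u / v) * (b - a))
        nlinarith
      have y3 : (u / v) ^ (b - a) ≤ 1 :=
        Real.rpow_le_one (by positivity) ((div_le_one hv0).2 huv.le) (by linarith)
      have y4 : 0 < v ^ (b - a) := Real.rpow_pos_of_pos hv0 _
      rw [y1]
      nlinarith
    calc u ^ a * v ^ (b - a) - u ^ a * u ^ (b - a)
        = u ^ a * (v ^ (b - a) - u ^ (b - a)) := by ring
      _ ≤ u ^ a * ((b - a) * (((v - u) / u) ^ a / a)) := by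
          refine mul_le_mul_of_nonneg_left (e2.trans ?_) hua.le
          exact mul_le_mul_of_nonneg_left e1 (by linarith)
      _ = _ := by
          rw [Real.div_rpow hh.le hu.le]; field_simp
  have key : (u ^ a - u ^ b) - (v ^ a - v ^ b) =
      (u ^ a * v ^ (b - a) - u ^ b) - (v ^ a - u ^ a) * (1 - v ^ (b - a)) := by
    rw [hvb]; ring
  rw [key]
  have h5 : (v ^ a - u ^ a) * (1 - v ^ (b - a)) ≤ (v - u) ^ a * ((b - a) * |Real.log (v - u)|) :=
    mul_le_mul hA' h3 h1 hp.le
  have h6 : 0 ≤ (v ^ a - u ^ a) * (1 - v ^ (b - a)) := mul_nonneg hA h1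
  obtain ⟨h7, h8⟩ := h4
  have h9 := h6.trans h5
  have h10 := h7.trans h8
  rw [abs_le]
  constructor <;> nlinarith

lemma second_diff' {u v a b c : ℝ} (hu : 0 ≤ u) (huv : u < v) (hv : v ≤ 1) (hc : 0 < c)
    (ha : c ≤ a) (hb : c ≤ b) (ha1 : a ≤ 1) (hb1 : b ≤ 1) :
    |(u ^ a - u ^ b) - (v ^ a - v ^ b)| ≤
      |a - b| * ((v - u) ^ (min a b) * (|Real.log (v - u)| + 1 / c)) := by
  wlog hab : a ≤ b generalizing a b
  · have := this hb ha hb1 ha1 (by linarith)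
    rw [abs_sub_comm b a, min_comm] at this
    rw [← abs_neg]
    convert this using 2
    ring
  rw [min_eq_left hab, abs_sub_comm a b, abs_of_nonneg (by linarith : 0 ≤ b - a)]
  refine (second_diff hu huv hv (by linarith) ha1 hab).trans ?_
  have : 0 < v - u := by linarith
  have : 0 ≤ b - a := by linarith
  gcongr

noncomputable def gG (x : ℝ) : ℝ := Real.Gamma (x + 1) * Real.sin (Real.pi * x / 2)

lemma gG_pos {x : ℝ} (h0 : 0 < x) (h2 : x < 2) : 0 < gG x := by
  refine mul_pos (Real.Gamma_pos_of_pos (by linarith)) (Real.sin_pos_of_pos_of_lt_pi ?_ ?_)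
  · have := Real.pi_pos; positivity
  · nlinarith [Real.pi_pos]

lemma gamma_analytic {x : ℝ} (h0 : 0 < x) : AnalyticAt ℝ Real.Gamma x := by
  have h : AnalyticAt ℂ Complex.Gamma (x : ℂ) := by
    have ho : IsOpen {z : ℂ | 0 < z.re} := isOpen_lt continuous_const Complex.continuous_re
    have hd : DifferentiableOn ℂ Complex.Gamma {z : ℂ | 0 < z.re} := by
      intro z hz
      refine (Complex.differentiableAt_Gamma z ?_).differentiableWithinAt
      intro m hm
      rw [hm] at hz
      simp at hz
      have : (0:ℝ) ≤ m := m.cast_nonneg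
      linarith
    exact hd.analyticAt (ho.mem_nhds (by simpa using h0))
  exact h.re_ofReal

lemma log_gG_analytic {x : ℝ} (h0 : 0 < x) (h2 : x < 2) :
    AnalyticAt ℝ (fun x => Real.log (gG x)) x := by
  refine AnalyticAt.log ?_ (gG_pos h0 h2)
  unfold gG
  refine AnalyticAt.mul ?_ ?_
  · exact AnalyticAt.fun_comp (g := Real.Gamma) (f := fun x => x + 1) (gamma_analytic (by linarith)) (by fun_prop)
  · fun_prop

lemma second_diff_bound {G : ℝ → ℝ} {l r : ℝ} (hG : ∀ x ∈ Icc l r, AnalyticAt ℝ G x) :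
    ∃ M ≥ (0:ℝ), ∀ x ∈ Icc l r, ∀ y ∈ Icc l r,
      |(G x + G y) / 2 - G ((x + y) / 2)| ≤ M * (x - y) ^ 2 := by
  have hcont : ContinuousOn (deriv (deriv G)) (Icc l r) :=
    fun x hx => (hG x hx).deriv.deriv.continuousAt.continuousWithinAt
  obtain ⟨C, hC⟩ := isCompact_Icc.exists_bound_of_continuousOn hcont
  refine ⟨max C 0, le_max_right _ _, ?_⟩
  have hlip : ∀ x ∈ Icc l r, ∀ y ∈ Icc l r, |deriv G y - deriv G x| ≤ max C 0 * |y - x| := by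
    intro x hx y hy
    exact Convex.norm_image_sub_le_of_norm_deriv_le (𝕜 := ℝ) (f := deriv G)
      (fun z hz => (hG z hz).deriv.differentiableAt)
      (fun z hz => (hC z hz).trans (le_max_left _ _)) (convex_Icc l r) hx hy
  intro x hx y hy
  wlog hxy : x ≤ y generalizing x y
  · have := this y hy x hx (by linarith)
    rwa [add_comm y x, add_comm (G y), ← neg_sub x y, neg_sq] at this
  rcases hxy.eq_or_lt with rfl | hxy
  · simp
  have hmem : ∀ z, x ≤ z → z ≤ y → z ∈ Icc l r := fun z h1 h2 => ⟨hx.1.trans h1, h2.trans hy.2⟩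
  obtain ⟨p, hp, hp'⟩ := exists_deriv_eq_slope G (a := x) (b := (x + y) / 2) (by linarith)
    (fun z hz => (hG z (hmem z hz.1 (by linarith [hz.2]))).continuousAt.continuousWithinAt)
    (fun z hz => (hG z (hmem z hz.1.le (by linarith [hz.2]))).differentiableAt.differentiableWithinAt)
  obtain ⟨q, hq, hq'⟩ := exists_deriv_eq_slope G (a := (x + y) / 2) (b := y) (by linarith)
    (fun z hz => (hG z (hmem z (by linarith [hz.1]) hz.2)).continuousAt.continuousWithinAt)
    (fun z hz => (hG z (hmem z (by linarith [hz.1]) hz.2.le)).differentiableAt.differentiableWithinAt)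
  have hl := hlip p (hmem p hp.1.le (by linarith [hp.2])) q (hmem q (by linarith [hq.1]) hq.2.le)
  rw [eq_div_iff (by linarith)] at hp' hq'
  have hpq : |q - p| ≤ y - x := by
    rw [abs_le]; constructor <;> linarith [hp.1, hp.2, hq.1, hq.2]
  have e : (G x + G y) / 2 - G ((x + y) / 2) = (deriv G q - deriv G p) * ((y - x) / 4) := by
    linear_combination (-1/2) * hq' + (1/2) * hp'
  have hM : 0 ≤ max C 0 := le_max_right _ _
  rw [e, abs_mul, abs_of_nonneg (by linarith : 0 ≤ (y - x) / 4)]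
  have h1 : |deriv G q - deriv G p| ≤ max C 0 * (y - x) :=
    hl.trans (mul_le_mul_of_nonneg_left hpq hM)
  have h2 : 0 ≤ max C 0 * (y - x) ^ 2 := by positivity
  nlinarith

lemma Dnorm_eq {a b : ℝ} (ha : 0 < a) (ha1 : a < 1) (hb : 0 < b) (hb1 : b < 1) :
    2 * Dnorm a b = Real.exp ((Real.log (gG (2 * a)) + Real.log (gG (2 * b))) / 2
      - Real.log (gG ((2 * a + 2 * b) / 2))) := by
  have pa := gG_pos (x := 2 * a) (by linarith) (by linarith)
  have pb := gG_pos (x := 2 * b) (by linarith) (by linarith)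
  have pm := gG_pos (x := (2 * a + 2 * b) / 2) (by linarith) (by linarith)
  rw [Real.exp_sub, Real.exp_log pm, Real.exp_half, Real.exp_add, Real.exp_log pa, Real.exp_log pb]
  unfold Dnorm
  have e1 : Real.Gamma (2 * a + 1) * Real.Gamma (2 * b + 1) *
      Real.sin (Real.pi * a) * Real.sin (Real.pi * b) = gG (2 * a) * gG (2 * b) := by
    unfold gG
    rw [show Real.pi * (2 * a) / 2 = Real.pi * a by ring,
      show Real.pi * (2 * b) / 2 = Real.pi * b by ring]; ring
  have e2 : 2 * Real.Gamma (a + b + 1) * Real.sin (Real.pi * (a + b) / 2) =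
      2 * gG ((2 * a + 2 * b) / 2) := by
    unfold gG
    rw [show (2 * a + 2 * b) / 2 = a + b by ring]; ring
  rw [e1, e2]
  field_simp

lemma Dnorm_self {a : ℝ} (ha : 0 < a) (ha1 : a < 1) : 2 * Dnorm a a = 1 := by
  rw [Dnorm_eq ha ha1 ha ha1]
  simp

lemma Dnorm_bound {lo hi : ℝ} (hlo : 0 < lo) (hhi : hi < 1) :
    ∃ M ≥ (0:ℝ), ∀ a ∈ Icc lo hi, ∀ b ∈ Icc lo hi, |1 - 2 * Dnorm a b| ≤ M * (a - b) ^ 2 := by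
  obtain ⟨M, hM, h⟩ := second_diff_bound (G := fun x => Real.log (gG x)) (l := 2 * lo) (r := 2 * hi)
    (fun x hx => log_gG_analytic (by linarith [hx.1]) (by linarith [hx.2]))
  refine ⟨4 * M * Real.exp (4 * M), by positivity, ?_⟩
  intro a ha b hb
  rw [Dnorm_eq (by linarith [ha.1]) (by linarith [ha.2]) (by linarith [hb.1]) (by linarith [hb.2])]
  have := h (2 * a) ⟨by linarith [ha.1], by linarith [ha.2]⟩ (2 * b)
    ⟨by linarith [hb.1], by linarith [hb.2]⟩
  set y := (Real.log (gG (2 * a)) + Real.log (gG (2 * b))) / 2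
      - Real.log (gG ((2 * a + 2 * b) / 2))
  have hab : (a - b) ^ 2 ≤ 1 := by
    have : |a - b| ≤ 1 := by
      rw [abs_le]; constructor <;> linarith [ha.1, ha.2, hb.1, hb.2]
    rw [← sq_abs]; nlinarith [abs_nonneg (a - b)]
  have h1 : |y| ≤ 4 * M * (a - b) ^ 2 := by nlinarith
  have h2 : |y| ≤ 4 * M := by nlinarith
  have hE : 1 ≤ Real.exp (4 * M) := Real.one_le_exp (by positivity)
  have h3 : |1 - Real.exp y| ≤ |y| * Real.exp (4 * M) := by
    rw [abs_le]
    have a1 := Real.add_one_le_exp y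
    have a2 := Real.add_one_le_exp (-y)
    have a3 : Real.exp (-y) * Real.exp y = 1 := by rw [← Real.exp_add]; simp
    have a4 : Real.exp y ≤ Real.exp (4 * M) := Real.exp_le_exp.2 ((le_abs_self y).trans h2)
    have a5 := Real.exp_pos y
    have a6 := le_abs_self y
    have a7 := neg_abs_le y
    have a8 := abs_nonneg y
    constructor
    · have : Real.exp y - 1 ≤ y * Real.exp y := by nlinarith
      have : y * Real.exp y ≤ |y| * Real.exp y := by nlinarith
      nlinarith
    · nlinarith
  calc _ ≤ _ := h3
    _ ≤ 4 * M * (a - b) ^ 2 * Real.exp (4 * M) := by gcongr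
    _ = _ := by ring

set_option maxHeartbeats 1000000 in
theorem stmt15 (H : ℝ → ℝ) (κ : NNReal)
    (hHlip : LipschitzOnWith κ H (Icc (0:ℝ) 1))
    (Hlo Hhi : ℝ) (hHlo : 0 < Hlo) (hHhi : Hhi < 1)
    (hHb : ∀ t ∈ Icc (0:ℝ) 1, Hlo ≤ H t ∧ H t ≤ Hhi) :
    ∃ Δ₀ > (0:ℝ), ∃ S ≥ (0:ℝ), ∃ β > (0:ℝ),
      ∀ u ∈ Icc (0:ℝ) 1, ∀ t ∈ Icc (0:ℝ) 1, ∀ v ∈ Icc (0:ℝ) 1,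
        u ≤ t → t ≤ v → |u - v| ≤ Δ₀ →
        |(mfbmCov H u u + mfbmCov H v v - 2 * mfbmCov H u v) -
            |u - v| ^ (2 * H t)| ≤ S * |u - v| ^ (2 * H t + 2 * β) := by
  obtain ⟨M, hM, hD⟩ := Dnorm_bound hHlo hHhi
  obtain ⟨k, hk⟩ : ∃ k : ℝ, k = κ := ⟨_, rfl⟩
  have hk0 : 0 ≤ k := hk ▸ κ.coe_nonneg
  obtain ⟨δ, hδ⟩ : ∃ δ : ℝ, δ = 1 - Hhi := ⟨_, rfl⟩
  have hδ0 : 0 < δ := by linarith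
  have hδ1 : δ < 1 := by
    have := hHb 0 ⟨le_rfl, zero_le_one⟩
    linarith [this.1, this.2]
  refine ⟨δ / (8 * (k + 1)), by positivity,
    3 * (M * k ^ 2) + (1 + k / Hlo) * (k / Hlo) + k * (4 / δ + 1 / Hlo) + 2 * k * (4 / δ),
    by positivity, δ / 4, by positivity, ?_⟩
  intro u hu t ht v hv hut htv hΔ
  have hLip : ∀ x ∈ Icc (0:ℝ) 1, ∀ y ∈ Icc (0:ℝ) 1, |H x - H y| ≤ k * |x - y| := by
    intro x hx y hy
    have := hHlip.dist_le_mul x hx y hy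
    rwa [Real.dist_eq, Real.dist_eq, ← hk] at this
  have hself : ∀ x ∈ Icc (0:ℝ) 1, mfbmCov H x x = x ^ (2 * H x) := by
    intro x hx
    have h1 := hHb x hx
    have h2 := Dnorm_self (a := H x) (by linarith [h1.1]) (by linarith [h1.2])
    unfold mfbmCov
    rw [sub_self, abs_zero, Real.zero_rpow (by linarith [h1.1]), ← two_mul (H x)]
    linear_combination x ^ (2 * H x) * h2
  have hat := hHb t ht
  rcases (hut.trans htv).eq_or_lt with rfl | huv
  · have : 2 * H t ≠ 0 := by linarith [hat.1]
    have h2 : 2 * H t + 2 * (δ / 4) ≠ 0 := by linarith [hat.1]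
    rw [sub_self, abs_zero, Real.zero_rpow this, Real.zero_rpow h2]
    simp; ring
  rw [hself u hu, hself v hv]
  have hLut := hLip u hu t ht
  have hLvt := hLip v hv t ht
  have hLuv := hLip u hu v hv
  have hau := hHb u hu
  have hav := hHb v hv
  unfold mfbmCov
  have habs : |u - v| = v - u := by rw [abs_sub_comm, abs_of_pos (by linarith)]
  rw [abs_sub_comm v u]
  have hut' : |u - t| ≤ v - u := by rw [abs_le]; constructor <;> linarith
  have hvt' : |v - t| ≤ v - u := by rw [abs_le]; constructor <;> linarith
  rw [habs] at hΔ hLuv ⊢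
  have hDuv := hD (H u) hau (H v) hav
  obtain ⟨D, hDd⟩ : ∃ D, D = Dnorm (H u) (H v) := ⟨_, rfl⟩
  rw [← hDd] at hDuv ⊢
  have hh : 0 < v - u := by linarith
  obtain ⟨h, hhd⟩ : ∃ h, h = v - u := ⟨_, rfl⟩
  obtain ⟨a, had⟩ : ∃ a, a = H u := ⟨_, rfl⟩
  obtain ⟨b, hbd⟩ : ∃ b, b = H v := ⟨_, rfl⟩
  obtain ⟨c, hcd⟩ : ∃ c, c = H t := ⟨_, rfl⟩
  have hsd := second_diff' hu.1 huv hv.2 hHlo hau.1 hav.1 (by linarith [hau.2]) (by linarith [hav.2])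
  have hUab := rpow_diff_exp hu.1 hu.2 hHlo hau.1 hav.1
  have hVab := rpow_diff_exp hv.1 hv.2 hHlo hau.1 hav.1
  have huva := rpow_sub_le hu.1 huv.le (by linarith [hau.1] : 0 ≤ H u) (by linarith [hau.2])
  have huva0 : u ^ H u ≤ v ^ H u := Real.rpow_le_rpow hu.1 huv.le (by linarith [hau.1])
  have hh1 : v - u ≤ 1 := by linarith [hu.1, hv.2]
  simp only [← hhd, ← had, ← hbd, ← hcd] at hΔ hLuv hLut hLvt hut' hvt' hau hav hat hDuv hh hh1 hsd hUab hVab huva huva0 ⊢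
  have hkh : k * h ≤ δ / 8 := by
    rw [le_div_iff₀ (by positivity)] at hΔ
    nlinarith
  have hac : |a - c| ≤ k * h := hLut.trans (mul_le_mul_of_nonneg_left hut' hk0)
  have hbc : |b - c| ≤ k * h := hLvt.trans (mul_le_mul_of_nonneg_left hvt' hk0)
  have hac' := abs_le.1 hac
  have hbc' := abs_le.1 hbc
  obtain ⟨R, hR⟩ : ∃ R, R = h ^ (2 * c + 2 * (δ / 4)) := ⟨_, rfl⟩
  rw [← hR]
  have hR0 : 0 < R := hR ▸ Real.rpow_pos_of_pos hh _
  have F : ∀ s, 2 * c + δ / 2 ≤ 1 + s → h * h ^ s ≤ R := by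
    intro s hs
    rw [hR, ← Real.rpow_one_add' hh.le (by linarith [hat.1])]
    exact Real.rpow_le_rpow_of_exponent_ge hh hh1 (by linarith)
  have FL : ∀ s, 2 * c + δ / 2 + δ / 4 ≤ 1 + s → h * (h ^ s * |Real.log h|) ≤ 4 / δ * R := by
    intro s hs
    have h1 := (Real.abs_log_mul_self_rpow_lt h (δ / 4) hh hh1 (by positivity)).le
    rw [abs_mul, abs_of_pos (Real.rpow_pos_of_pos hh _), one_div_div] at h1
    have h2 : h ^ s = h ^ (s - δ / 4) * h ^ (δ / 4) := by
      rw [← Real.rpow_add hh]; ring_nf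
    have h3 := F (s - δ / 4) (by linarith)
    calc h * (h ^ s * |Real.log h|) = (|Real.log h| * h ^ (δ / 4)) * (h * h ^ (s - δ / 4)) := by
          rw [h2]; ring
      _ ≤ _ := by
          have := Real.rpow_pos_of_pos hh (s - δ / 4)
          gcongr
  have hmin : c - δ / 8 ≤ min a b := le_min (by linarith) (by linarith)
  have hmin2 : 2 * c - δ / 4 ≤ min (a + b) (2 * c) := le_min (by linarith) (by linarith)
  have F1 : h * h ≤ R := by
    have := F 1 (by linarith)
    rwa [Real.rpow_one] at this
  have F2 : h * h ^ a ≤ R := F a (by linarith)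
  have F3 := F (min a b) (by linarith)
  have F4 := FL (min a b) (by linarith)
  have F5 := FL (min (a + b) (2 * c)) (by linarith)
  -- covariance normalisation term
  have T1 : |(1 - 2 * D) * (u ^ (a + b) + v ^ (a + b) - h ^ (a + b))| ≤ 3 * (M * k ^ 2) * R := by
    have hab0 : 0 ≤ a + b := by linarith [hau.1, hav.1]
    have g1 := Real.rpow_le_one hu.1 hu.2 hab0
    have g2 := Real.rpow_le_one hv.1 hv.2 hab0
    have g3 := Real.rpow_le_one hh.le hh1 hab0
    have g1' := Real.rpow_nonneg hu.1 (a + b)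
    have g2' := Real.rpow_nonneg hv.1 (a + b)
    have g3' := Real.rpow_nonneg hh.le (a + b)
    have g4 : |u ^ (a + b) + v ^ (a + b) - h ^ (a + b)| ≤ 3 := by
      rw [abs_le]; constructor <;> linarith
    have g5 : (a - b) ^ 2 ≤ k ^ 2 * (h * h) := by
      rw [← sq_abs]
      calc |a - b| ^ 2 ≤ (k * h) ^ 2 := pow_le_pow_left₀ (abs_nonneg _) hLuv 2
        _ = _ := by ring
    have g6 : |1 - 2 * D| ≤ M * (k ^ 2 * R) := by
      refine hDuv.trans ?_
      gcongr
      refine g5.trans ?_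
      gcongr
    rw [abs_mul]
    calc _ ≤ M * (k ^ 2 * R) * 3 := by gcongr
      _ = _ := by ring
  have T4 : |h ^ (a + b) - h ^ (2 * c)| ≤ 2 * k * (4 / δ) * R := by
    refine (rpow_diff_log hh hh1).trans ?_
    have g1 : |a + b - 2 * c| ≤ 2 * (k * h) := by
      rw [abs_le]; constructor <;> linarith
    have := Real.rpow_pos_of_pos hh (min (a + b) (2 * c))
    calc _ ≤ 2 * (k * h) * |Real.log h| * h ^ (min (a + b) (2 * c)) := by gcongr
      _ = 2 * k * (h * (h ^ (min (a + b) (2 * c)) * |Real.log h|)) := by ring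
      _ ≤ 2 * k * (4 / δ * R) := by gcongr
      _ = _ := by ring
  have hdk : |a - b| / Hlo ≤ k / Hlo * h := by
    rw [div_mul_eq_mul_div]; gcongr
  have T2 : |(u ^ a - v ^ b) * (u ^ a - u ^ b)| ≤ (1 + k / Hlo) * (k / Hlo) * R := by
    rw [abs_mul]
    have g1 : |u ^ a - v ^ b| ≤ h ^ a + k / Hlo * h := by
      have e1 := abs_le.1 (hVab.trans hdk)
      have : 0 ≤ k / Hlo * h := by positivity
      rw [abs_le]; constructor <;> linarith [e1.1, e1.2, Real.rpow_pos_of_pos hh a]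
    have := Real.rpow_pos_of_pos hh a
    calc _ ≤ (h ^ a + k / Hlo * h) * (k / Hlo * h) := by
          gcongr
          exact hUab.trans hdk
      _ = k / Hlo * (h * h ^ a) + k / Hlo * (k / Hlo) * (h * h) := by ring
      _ ≤ k / Hlo * R + k / Hlo * (k / Hlo) * R := by gcongr
      _ = _ := by ring
  have T3 : |v ^ b * ((u ^ a - u ^ b) - (v ^ a - v ^ b))| ≤ k * (4 / δ + 1 / Hlo) * R := by
    rw [abs_mul, abs_of_nonneg (Real.rpow_nonneg hv.1 b)]
    have g1 := Real.rpow_le_one hv.1 hv.2 (by linarith [hav.1] : 0 ≤ b)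
    have := Real.rpow_pos_of_pos hh (min a b)
    calc _ ≤ 1 * ((k * h) * (h ^ (min a b) * (|Real.log h| + 1 / Hlo))) := by
          refine mul_le_mul g1 (hsd.trans ?_) (abs_nonneg _) zero_le_one
          gcongr
      _ = k * (h * (h ^ (min a b) * |Real.log h|)) + k * (1 / Hlo) * (h * h ^ (min a b)) := by ring
      _ ≤ k * (4 / δ * R) + k * (1 / Hlo) * R := by gcongr
      _ = _ := by ring
  have sq : ∀ x : ℝ, 0 ≤ x → ∀ p q : ℝ, Hlo ≤ p → Hlo ≤ q → x ^ (p + q) = x ^ p * x ^ q := by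
    intro x hx p q hp hq
    exact Real.rpow_add_of_nonneg hx (by linarith) (by linarith)
  have key : u ^ (2 * a) + v ^ (2 * b) - 2 * (D * (u ^ (a + b) + v ^ (a + b) - h ^ (a + b)))
      - h ^ (2 * c) = (1 - 2 * D) * (u ^ (a + b) + v ^ (a + b) - h ^ (a + b))
      + (u ^ a - v ^ b) * (u ^ a - u ^ b) + v ^ b * ((u ^ a - u ^ b) - (v ^ a - v ^ b))
      + (h ^ (a + b) - h ^ (2 * c)) := by
    rw [two_mul a, two_mul b, sq u hu.1 a a hau.1 hau.1, sq v hv.1 b b hav.1 hav.1,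
      sq u hu.1 a b hau.1 hav.1, sq v hv.1 a b hau.1 hav.1]
    ring
  rw [key]
  refine (abs_add_le _ _).trans ?_
  refine (add_le_add ((abs_add_le _ _).trans (add_le_add (abs_add_le _ _) le_rfl)) le_rfl).trans ?_
  linarith
end

section
/- Let H : [0,1] → (0,1) and L : [0,1] → (0,∞) be Lipschitz continuous with 0 < H̲ ≤ H̄ < 1 and 0 < L̲ ≤ L̄ < ∞. Define the time deformation A(t) = A(0) + ∫₀ᵗ L_s^{1/H_s} ds with A(0) ≥ 0, and the kernel C_A(s,t) = D(H_s, H_t)·[ A(s)^{H_s+H_t} + A(t)^{H_s+H_t} − |A(t) − A(s)|^{H_s+H_t} ] for s, t ∈ [0,1]. Then: (i) C_A(t,t) = A(t)^{2H_t} for every t ∈ [0,1]; and (ii) the increment-variance function θ_A(u,v) = C_A(u,u) + C_A(v,v) − 2C_A(u,v) satisfies the local regularity condition: there exist Δ₀ > 0, S ≥ 0 and β > 0 such that for all u ≤ t ≤ v in [0,1] with |u − v| ≤ Δ₀, | θ_A(u,v) − L_t²·|u − v|^{2H_t} | ≤ S·|u − v|^{2H_t + 2β}. -/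
open Set

/-- The time deformation `A(t) = A(0) + ∫₀ᵗ L_s^{1/H_s} ds`. -/
noncomputable def Adef (H L : ℝ → ℝ) (A0 t : ℝ) : ℝ :=
  A0 + ∫ s in (0:ℝ)..t, L s ^ (1 / H s)

/-- The kernel `C_A` of the time-deformed multifractional Brownian motion. -/
noncomputable def covA (H L : ℝ → ℝ) (A0 : ℝ) (s t : ℝ) : ℝ :=
  Dnorm (H s) (H t) *
    (Adef H L A0 s ^ (H s + H t) + Adef H L A0 t ^ (H s + H t) -
      |Adef H L A0 t - Adef H L A0 s| ^ (H s + H t))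

theorem aux_wlogw_bound (M : ℝ) : ∃ B ≥ (0:ℝ), ∀ w ∈ Icc (0:ℝ) M, |w * Real.log w| ≤ B := by
  obtain ⟨B, hB⟩ := isCompact_Icc.exists_bound_of_continuousOn
    (s := Icc (0:ℝ) M) (f := fun w => w * Real.log w) Real.continuous_mul_log.continuousOn
  exact ⟨max B 0, le_max_right _ _, fun w hw => (hB w hw).trans (le_max_left _ _)⟩

theorem aux_w2logw (M : ℝ) (hM : 0 ≤ M) : ∃ C ≥ (0:ℝ), ∀ a ∈ Icc (0:ℝ) M, ∀ b ∈ Icc (0:ℝ) M, a ≤ b →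
    |b ^ 2 * Real.log b - a ^ 2 * Real.log a| ≤ C * (b - a) := by
  obtain ⟨B, hB0, hB⟩ := aux_wlogw_bound M
  refine ⟨2 * B + M, by positivity, fun a ha b hb hab => ?_⟩
  rcases eq_or_lt_of_le ha.1 with h0 | h0
  · subst h0
    have := hB b hb
    have h1 : b ^ 2 * Real.log b - 0 ^ 2 * Real.log 0 = b * (b * Real.log b) := by ring
    rw [h1, abs_mul, abs_of_nonneg hb.1]
    nlinarith [hb.1, mul_le_mul_of_nonneg_left this hb.1, mul_nonneg hB0 hb.1, mul_nonneg hM hb.1]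
  · have := (convex_Icc a b).norm_image_sub_le_of_norm_hasDerivWithin_le
      (f := fun w => w ^ 2 * Real.log w) (f' := fun w => 2 * (w * Real.log w) + w)
      (C := 2 * B + M) (x := a) (y := b) ?_ ?_ (left_mem_Icc.2 hab) (right_mem_Icc.2 hab)
    · rwa [Real.norm_eq_abs, Real.norm_eq_abs, abs_of_nonneg (sub_nonneg.2 hab)] at this
    · intro w hw
      have hw0 : w ≠ 0 := (h0.trans_le hw.1).ne'
      have := ((hasDerivAt_pow 2 w).mul (Real.hasDerivAt_log hw0)).hasDerivWithinAt (s := Icc a b)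
      refine this.congr_deriv ?_
      field_simp
      try ring
    · intro w hw
      have hw' : w ∈ Icc (0:ℝ) M := ⟨h0.le.trans hw.1, hw.2.trans hb.2⟩
      rw [Real.norm_eq_abs]
      have h1 := abs_le.1 (hB w hw')
      rw [abs_le]
      constructor <;> nlinarith [hw'.1, hw'.2, h1.1, h1.2]

theorem aux_rpow_deriv (z h : ℝ) (hz : 0 ≤ z) (hh : 0 < h) :
    HasDerivAt (fun h => z ^ h) (z ^ h * Real.log z) h := by
  rcases eq_or_lt_of_le hz with h0 | h0
  · subst h0
    simp only [Real.log_zero, mul_zero]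
    refine (hasDerivAt_const h (0:ℝ)).congr_of_eventuallyEq ?_
    filter_upwards [lt_mem_nhds hh] with k hk
    exact Real.zero_rpow hk.ne'
  · exact (Real.hasStrictDerivAt_const_rpow h0 h).hasDerivAt

theorem aux_rpow_mem (M : ℝ) (hM : 1 ≤ M) (z k : ℝ) (hz : z ∈ Icc (0:ℝ) M) (hk0 : 0 ≤ k) (hk : k ≤ 1) :
    z ^ k ∈ Icc (0:ℝ) M := by
  refine ⟨Real.rpow_nonneg hz.1 _, ?_⟩
  calc z ^ k ≤ M ^ k := Real.rpow_le_rpow hz.1 hz.2 hk0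
    _ ≤ M ^ (1:ℝ) := Real.rpow_le_rpow_of_exponent_le hM hk
    _ = M := Real.rpow_one M

theorem aux_log_rpow (z k : ℝ) (hz : 0 ≤ z) (hk : 0 < k) : Real.log z = Real.log (z ^ k) / k := by
  rcases eq_or_lt_of_le hz with h0 | h0
  · subst h0; simp [Real.zero_rpow hk.ne']
  · rw [Real.log_rpow h0]; field_simp

theorem aux_exp_lip (M lo : ℝ) (hM : 1 ≤ M) (hlo : 0 < lo) : ∃ C ≥ (0:ℝ), ∀ z ∈ Icc (0:ℝ) M,
    ∀ p ∈ Icc lo 1, ∀ q ∈ Icc lo 1, |z ^ p - z ^ q| ≤ C * |p - q| := by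
  obtain ⟨B, hB0, hB⟩ := aux_wlogw_bound M
  refine ⟨B / lo, by positivity, fun z hz p hp q hq => ?_⟩
  refine (convex_Icc lo 1).norm_image_sub_le_of_norm_hasDerivWithin_le
      (f := fun h => z ^ h) (f' := fun h => z ^ h * Real.log z)
      (C := B / lo) (x := q) (y := p) ?_ ?_ hq hp
  · intro h hh
    exact (aux_rpow_deriv z h hz.1 (hlo.trans_le hh.1)).hasDerivWithinAt
  · intro h hh
    have h0 := hlo.trans_le hh.1
    rw [Real.norm_eq_abs, aux_log_rpow z h hz.1 h0, ← mul_div_assoc, abs_div, abs_of_pos h0]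
    exact div_le_div₀ hB0 (hB _ (aux_rpow_mem M hM z h hz h0.le hh.2)) hlo hh.1

theorem aux_rpow_sub (a b k : ℝ) (ha : 0 ≤ a) (hab : a ≤ b) (hk0 : 0 ≤ k) (hk : k ≤ 1) :
    b ^ k - a ^ k ≤ (b - a) ^ k := by
  have := Real.rpow_add_le_add_rpow ha (sub_nonneg.2 hab) hk0 hk
  rw [add_sub_cancel] at this
  linarith

theorem aux_double (M lo : ℝ) (hM : 1 ≤ M) (hlo : 0 < lo) : ∃ C ≥ (0:ℝ), ∀ a ∈ Icc (0:ℝ) M,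
    ∀ b ∈ Icc (0:ℝ) M, a ≤ b → ∀ x ∈ Icc lo 1, ∀ y ∈ Icc lo 1, ∀ R : ℝ,
    (∀ k ∈ uIcc x y, (b - a) ^ k ≤ R) →
    |(b ^ (2 * x) - a ^ (2 * x)) - (b ^ (x + y) - a ^ (x + y))| ≤ C * R * |x - y| := by
  obtain ⟨C, hC0, hC⟩ := aux_w2logw M (by linarith)
  refine ⟨C / lo, by positivity, fun a ha b hb hab x hx y hy R hR => ?_⟩
  have hsub : uIcc x y ⊆ Icc lo 1 := uIcc_subset_Icc hx hy
  have hmean := (convex_uIcc (2 * x) (2 * y)).norm_image_sub_le_of_norm_hasDerivWithin_le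
      (f := fun h => b ^ h - a ^ h) (f' := fun h => b ^ h * Real.log b - a ^ h * Real.log a)
      (C := C / lo * R) (x := x + y) (y := 2 * x) ?_ ?_ ?_ left_mem_uIcc
  · rw [Real.norm_eq_abs, Real.norm_eq_abs] at hmean
    rwa [show 2 * x - (x + y) = x - y by ring] at hmean
  · intro h hh
    have h0 : 0 < h := by
      have : Icc (2 * lo) 2 ⊇ uIcc (2 * x) (2 * y) := uIcc_subset_Icc
        ⟨by linarith [hx.1], by linarith [hx.2]⟩ ⟨by linarith [hy.1], by linarith [hy.2]⟩
      have := (this hh).1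
      linarith
    exact ((aux_rpow_deriv b h hb.1 h0).sub (aux_rpow_deriv a h ha.1 h0)).hasDerivWithinAt
  · intro h hh
    have hk' : h / 2 ∈ uIcc x y := by
      rw [mem_uIcc] at hh ⊢
      rcases hh with hh | hh
      · left; constructor <;> linarith [hh.1, hh.2]
      · right; constructor <;> linarith [hh.1, hh.2]
    obtain ⟨k, rfl⟩ : ∃ k, h = 2 * k := ⟨h / 2, by ring⟩
    have hk : k ∈ uIcc x y := by simpa using hk'
    have hkl := hsub hk
    have hk0 : 0 < k := hlo.trans_le hkl.1
    have e : ∀ z, 0 ≤ z → z ^ (2 * k) * Real.log z = ((z ^ k) ^ 2 * Real.log (z ^ k)) / k := by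
      intro z hz
      rw [aux_log_rpow z k hz hk0, mul_comm 2 k, Real.rpow_mul hz, Real.rpow_two]
      ring
    rw [e a ha.1, e b hb.1, ← sub_div, Real.norm_eq_abs, abs_div, abs_of_pos hk0]
    have hma := aux_rpow_mem M hM a k ha hk0.le hkl.2
    have hmb := aux_rpow_mem M hM b k hb hk0.le hkl.2
    have h1 := hC _ hma _ hmb (Real.rpow_le_rpow ha.1 hab hk0.le)
    have h2 := (aux_rpow_sub a b k ha.1 hab hk0.le hkl.2).trans (hR k hk)
    have hR0 : 0 ≤ R := (Real.rpow_nonneg (sub_nonneg.2 hab) k).trans (hR k hk)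
    calc _ ≤ (C * R) / lo := div_le_div₀ (by positivity)
          (h1.trans (mul_le_mul_of_nonneg_left h2 hC0)) hlo hkl.1
      _ = C / lo * R := by ring
  · rw [mem_uIcc]
    rcases le_total x y with h | h
    · left; constructor <;> linarith
    · right; constructor <;> linarith
theorem aux_Gamma_contDiffAt (s : ℝ) (hs : 0 < s) : ContDiffAt ℝ 2 Real.Gamma s := by
  have hC : ContDiffAt ℂ 2 Complex.Gamma (s : ℂ) := by
    have hd : DifferentiableOn ℂ Complex.Gamma {z : ℂ | 0 < z.re} := by
      intro z hz
      refine (Complex.differentiableAt_Gamma z fun m h => ?_).differentiableWithinAt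
      rw [h] at hz
      have : (0:ℝ) < -(m:ℝ) := by simpa using hz
      have h2 : (0:ℝ) ≤ m := Nat.cast_nonneg m
      linarith
    have ho : IsOpen {z : ℂ | 0 < z.re} := isOpen_lt continuous_const Complex.continuous_re
    exact (hd.contDiffOn ho).contDiffAt (ho.mem_nhds (by simpa using hs))
  exact hC.real_of_complex

/-- auxiliary logarithm of `Γ(z+1) sin(πz/2)` -/
noncomputable def auxF (z : ℝ) : ℝ := Real.Gamma (z + 1) * Real.sin (Real.pi * z / 2)

theorem auxF_pos (z : ℝ) (hz : 0 < z) (hz2 : z < 2) : 0 < auxF z := by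
  unfold auxF
  refine mul_pos (Real.Gamma_pos_of_pos (by linarith)) (Real.sin_pos_of_pos_of_lt_pi ?_ ?_)
  · have := Real.pi_pos; positivity
  · nlinarith [Real.pi_pos]

theorem auxF_contDiffAt (z : ℝ) (hz : 0 < z) : ContDiffAt ℝ 2 auxF z := by
  unfold auxF
  refine ContDiffAt.mul ?_ ?_
  · exact ContDiffAt.comp (g := Real.Gamma) (f := fun z : ℝ => z + 1) z
      (aux_Gamma_contDiffAt (z + 1) (by linarith)) (by fun_prop)
  · exact (Real.contDiff_sin.comp (by fun_prop)).contDiffAt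

theorem Dnorm_eq_s16 (x y : ℝ) : Dnorm x y =
    Real.sqrt (auxF (2 * x) * auxF (2 * y)) / (2 * auxF (x + y)) := by
  unfold Dnorm auxF
  rw [show Real.pi * (2 * x) / 2 = Real.pi * x by ring, show Real.pi * (2 * y) / 2 = Real.pi * y by ring]
  congr 1
  · congr 1; ring
  · ring

theorem Dnorm_self_s16 (x : ℝ) (hx : 0 < x) (hx1 : x < 1) : Dnorm x x = 1 / 2 := by
  have := auxF_pos (2 * x) (by linarith) (by linarith)
  rw [Dnorm_eq_s16, Real.sqrt_mul_self this.le, ← two_mul]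
  field_simp

theorem aux_midpoint (f : ℝ → ℝ) (lo hi : ℝ) (hlo : lo ≤ hi) (hf : ∀ z ∈ Icc lo hi, ContDiffAt ℝ 2 f z) :
    ∃ C ≥ (0:ℝ), ∀ p ∈ Icc lo hi, ∀ q ∈ Icc lo hi, p ≤ q →
      |f p + f q - 2 * f ((p + q) / 2)| ≤ C * (q - p) ^ 2 := by
  have hd : ContDiffOn ℝ 1 (deriv f) (Icc lo hi) := fun z hz => by
    have h1 : ContDiffAt ℝ 1 (fderiv ℝ f) z := (hf z hz).fderiv_right (by norm_num)
    have h2 : ContDiffAt ℝ 1 (fun w => fderiv ℝ f w 1) z := h1.clm_apply contDiffAt_const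
    exact h2.contDiffWithinAt
  obtain ⟨K, hK⟩ := hd.exists_lipschitzOnWith one_ne_zero (convex_Icc _ _) isCompact_Icc
  refine ⟨K, K.2, fun p hp q hq hpq => ?_⟩
  set d := (q - p) / 2 with hdd
  have hd0 : 0 ≤ d := by rw [hdd]; linarith
  have hin : ∀ w ∈ Icc p ((p + q) / 2), w ∈ Icc lo hi ∧ w + d ∈ Icc lo hi := by
    intro w hw
    refine ⟨⟨hp.1.trans hw.1, ?_⟩, ⟨?_, ?_⟩⟩ <;> linarith [hw.1, hw.2, hp.1, hq.2]
  have hmean := (convex_Icc p ((p + q) / 2)).norm_image_sub_le_of_norm_hasDerivWithin_le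
      (f := fun w => f (w + d) - f w) (f' := fun w => deriv f (w + d) - deriv f w)
      (C := K * d) (x := p) (y := (p + q) / 2) ?_ ?_ ⟨le_rfl, by linarith⟩ ⟨by linarith, le_rfl⟩
  · have e1 : (p + q) / 2 + d = q := by rw [hdd]; ring
    have e2 : p + d = (p + q) / 2 := by rw [hdd]; ring
    simp only [e1, e2, Real.norm_eq_abs] at hmean
    rw [show (p + q) / 2 - p = d by rw [hdd]; ring, abs_of_nonneg hd0] at hmean
    calc _ = |f q - f ((p + q) / 2) - (f ((p + q) / 2) - f p)| := by congr 1; ring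
      _ ≤ K * d * d := hmean
      _ ≤ K * (q - p) ^ 2 := by
        have : (q - p) = 2 * d := by rw [hdd]; ring
        rw [this]
        nlinarith [mul_nonneg K.2 (mul_self_nonneg d)]
  · intro w hw
    have hh := hin w hw
    have g1 := ((hf _ hh.1).differentiableAt (by norm_num)).hasDerivAt
    have g2 := ((hf _ hh.2).differentiableAt (by norm_num)).hasDerivAt.comp_add_const w d
    exact (g2.sub g1).hasDerivWithinAt
  · intro w hw
    have hh := hin w hw
    have := hK.dist_le_mul _ hh.2 _ hh.1
    rw [Real.dist_eq, Real.dist_eq, add_sub_cancel_left, abs_of_nonneg hd0] at this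
    exact this

theorem aux_exp_bound (W : ℝ) : ∃ C ≥ (0:ℝ), ∀ w : ℝ, |w| ≤ W → |Real.exp w - 1| ≤ C * |w| := by
  obtain ⟨K, hK⟩ := (Real.contDiff_exp (n := 1)).contDiffOn.exists_lipschitzOnWith
    one_ne_zero (convex_Icc (-W) W) isCompact_Icc
  refine ⟨K, K.2, fun w hw => ?_⟩
  have hW : 0 ≤ W := (abs_nonneg w).trans hw
  have := hK.dist_le_mul w (abs_le.1 hw) 0 ⟨by linarith, hW⟩
  simpa [Real.dist_eq] using this

theorem aux_D (lo hi : ℝ) (hlo : 0 < lo) (hhi : hi < 1) : ∃ C ≥ (0:ℝ),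
    ∀ x ∈ Icc lo hi, ∀ y ∈ Icc lo hi, |2 * Dnorm x y - 1| ≤ C * (x - y) ^ 2 := by
  rcases lt_or_ge hi lo with hl | hl
  · exact ⟨0, le_rfl, fun x hx => absurd (hx.1.trans hx.2) (not_le.2 hl)⟩
  obtain ⟨C, hC0, hC⟩ := aux_midpoint (fun z => Real.log (auxF z)) (2 * lo) (2 * hi) (by linarith) (by
    intro z hz
    have h0 : 0 < z := by linarith [hz.1]
    exact (auxF_contDiffAt z h0).log (auxF_pos z h0 (by linarith [hz.2])).ne')
  have hC' : ∀ x ∈ Icc lo hi, ∀ y ∈ Icc lo hi, |Real.log (auxF (2 * x)) + Real.log (auxF (2 * y))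
      - 2 * Real.log (auxF (x + y))| ≤ 4 * C * (x - y) ^ 2 := by
    have key : ∀ x ∈ Icc lo hi, ∀ y ∈ Icc lo hi, x ≤ y → |Real.log (auxF (2 * x)) +
        Real.log (auxF (2 * y)) - 2 * Real.log (auxF (x + y))| ≤ 4 * C * (x - y) ^ 2 := by
      intro x hx y hy hxy
      have := hC (2 * x) ⟨by linarith [hx.1], by linarith [hx.2]⟩ (2 * y)
        ⟨by linarith [hy.1], by linarith [hy.2]⟩ (by linarith)
      simp only [show (2 * x + 2 * y) / 2 = x + y by ring] at this
      refine this.trans (le_of_eq ?_)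
      ring
    intro x hx y hy
    rcases le_total x y with h | h
    · exact key x hx y hy h
    · have := key y hy x hx h
      rwa [add_comm y x, add_comm (Real.log (auxF (2 * y))), show (y - x) ^ 2 = (x - y) ^ 2 by ring] at this
  obtain ⟨E, hE0, hE⟩ := aux_exp_bound (4 * C)
  refine ⟨E * (4 * C), by positivity, fun x hx y hy => ?_⟩
  have px := auxF_pos (2 * x) (by linarith [hx.1]) (by linarith [hx.2])
  have py := auxF_pos (2 * y) (by linarith [hy.1]) (by linarith [hy.2])
  have pm := auxF_pos (x + y) (by linarith [hx.1, hy.1]) (by linarith [hx.2, hy.2])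
  set w := (Real.log (auxF (2 * x)) + Real.log (auxF (2 * y)) - 2 * Real.log (auxF (x + y))) / 2 with hw
  have hwb : |w| ≤ 4 * C * (x - y) ^ 2 := by
    rw [hw, abs_div, abs_two]
    have := hC' x hx y hy
    have h2 := abs_nonneg (Real.log (auxF (2 * x)) + Real.log (auxF (2 * y)) - 2 * Real.log (auxF (x + y)))
    linarith
  have hxy : (x - y) ^ 2 ≤ 1 := by
    rw [sq_le_one_iff_abs_le_one, abs_le]
    constructor <;> linarith [hx.1, hx.2, hy.1, hy.2]
  have hD : 2 * Dnorm x y = Real.exp w := by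
    rw [Dnorm_eq_s16, Real.sqrt_eq_rpow, Real.rpow_def_of_pos (mul_pos px py), Real.log_mul px.ne' py.ne']
    rw [show w = (Real.log (auxF (2 * x)) + Real.log (auxF (2 * y))) * (1 / 2)
      - Real.log (auxF (x + y)) by rw [hw]; ring, Real.exp_sub, Real.exp_log pm]
    field_simp
  rw [hD]
  calc _ ≤ E * |w| := hE w (hwb.trans (by nlinarith))
    _ ≤ E * (4 * C * (x - y) ^ 2) := mul_le_mul_of_nonneg_left hwb hE0
    _ = _ := by ring
theorem aux_rpow_lip (m M lo hi : ℝ) (hm : 0 < m) (hlo : 0 < lo) : ∃ K ≥ (0:ℝ),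
    ∀ a ∈ Icc m M, ∀ b ∈ Icc m M, ∀ p ∈ Icc lo hi, ∀ q ∈ Icc lo hi,
    |a ^ p - b ^ q| ≤ K * (|a - b| + |p - q|) ∧
    |a ^ (1 / p) - b ^ (1 / q)| ≤ K * (|a - b| + |p - q|) := by
  have c1 : ContDiffOn ℝ 1 (fun z : ℝ × ℝ => z.1 ^ z.2) (Icc m M ×ˢ Icc lo hi) := by
    intro z hz
    exact (Real.contDiffAt_rpow_of_ne z (hm.trans_le hz.1.1).ne').contDiffWithinAt
  have c2 : ContDiffOn ℝ 1 (fun z : ℝ × ℝ => z.1 ^ (1 / z.2)) (Icc m M ×ˢ Icc lo hi) := by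
    intro z hz
    have h1 : ContDiffAt ℝ 1 (fun z : ℝ × ℝ => (1:ℝ) / z.2) z :=
      contDiffAt_const.div contDiffAt_snd (hlo.trans_le hz.2.1).ne'
    exact (ContDiffAt.rpow contDiffAt_fst h1 (hm.trans_le hz.1.1).ne').contDiffWithinAt
  have hcv : Convex ℝ (Icc m M ×ˢ Icc lo hi) := (convex_Icc _ _).prod (convex_Icc _ _)
  have hcp : IsCompact (Icc m M ×ˢ Icc lo hi) := isCompact_Icc.prod isCompact_Icc
  obtain ⟨K1, hK1⟩ := c1.exists_lipschitzOnWith one_ne_zero hcv hcp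
  obtain ⟨K2, hK2⟩ := c2.exists_lipschitzOnWith one_ne_zero hcv hcp
  refine ⟨K1 + K2, add_nonneg K1.2 K2.2, fun a ha b hb p hp q hq => ?_⟩
  have h1 := hK1.dist_le_mul (a, p) ⟨ha, hp⟩ (b, q) ⟨hb, hq⟩
  have h2 := hK2.dist_le_mul (a, p) ⟨ha, hp⟩ (b, q) ⟨hb, hq⟩
  have hmx : dist (a, p) (b, q) ≤ |a - b| + |p - q| := by
    rw [Prod.dist_eq, Real.dist_eq, Real.dist_eq]
    exact max_le (by simp) (by simp)
  have hn : 0 ≤ |a - b| + |p - q| := by positivity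
  have k1 : (0:ℝ) ≤ K1 := K1.2
  have k2 : (0:ℝ) ≤ K2 := K2.2
  rw [Real.dist_eq] at h1 h2
  constructor
  · refine h1.trans ?_
    nlinarith [mul_le_mul_of_nonneg_left hmx k1, mul_nonneg k2 hn]
  · refine h2.trans ?_
    nlinarith [mul_le_mul_of_nonneg_left hmx k2, mul_nonneg k1 hn]

theorem aux_A (H L : ℝ → ℝ) (κH κL : NNReal)
    (hHlip : LipschitzOnWith κH H (Icc (0:ℝ) 1))
    (hLlip : LipschitzOnWith κL L (Icc (0:ℝ) 1))
    (Hlo Hhi Llo Lhi : ℝ) (hHlo : 0 < Hlo) (hLlo : 0 < Llo)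
    (hHb : ∀ t ∈ Icc (0:ℝ) 1, Hlo ≤ H t ∧ H t ≤ Hhi)
    (hLb : ∀ t ∈ Icc (0:ℝ) 1, Llo ≤ L t ∧ L t ≤ Lhi)
    (A0 : ℝ) (hA0 : 0 ≤ A0) :
    ∃ m > (0:ℝ), ∃ M ≥ (1:ℝ), ∃ C ≥ (0:ℝ),
      (∀ t ∈ Icc (0:ℝ) 1, Adef H L A0 t ∈ Icc (0:ℝ) M) ∧
      ∀ u ∈ Icc (0:ℝ) 1, ∀ t ∈ Icc (0:ℝ) 1, ∀ v ∈ Icc (0:ℝ) 1, u ≤ t → t ≤ v → u < v →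
        ∃ ρ ∈ Icc m M, ∃ σ ∈ Icc m M, Adef H L A0 v - Adef H L A0 u = ρ * (v - u) ∧
          |ρ - σ| ≤ C * (v - u) ∧ σ ^ (2 * H t) = L t ^ 2 := by
  obtain ⟨K, hK0, hK⟩ := aux_rpow_lip Llo Lhi Hlo Hhi hLlo hHlo
  set s : ℝ → ℝ := fun t => L t ^ (1 / H t) with hs
  set C : ℝ := K * (κL + κH) with hCdef
  have hC0 : 0 ≤ C := by positivity
  have hlip : ∀ p ∈ Icc (0:ℝ) 1, ∀ q ∈ Icc (0:ℝ) 1, |s p - s q| ≤ C * |p - q| := by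
    intro p hp q hq
    have h1 := (hK (L p) (hLb p hp) (L q) (hLb q hq) (H p) (hHb p hp) (H q) (hHb q hq)).2
    have h2 := hHlip.dist_le_mul p hp q hq
    have h3 := hLlip.dist_le_mul p hp q hq
    rw [Real.dist_eq, Real.dist_eq] at h2 h3
    calc _ ≤ K * (|L p - L q| + |H p - H q|) := h1
      _ ≤ K * (κL * |p - q| + κH * |p - q|) := by gcongr
      _ = C * |p - q| := by rw [hCdef]; ring
  have hcont : ContinuousOn s (Icc 0 1) := by
    have : LipschitzOnWith ⟨C, hC0⟩ s (Icc 0 1) := LipschitzOnWith.of_dist_le_mul (by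
      intro p hp q hq
      rw [Real.dist_eq, Real.dist_eq]
      exact hlip p hp q hq)
    exact this.continuousOn
  have hpos : ∀ p ∈ Icc (0:ℝ) 1, 0 < s p := fun p hp =>
    Real.rpow_pos_of_pos (hLlo.trans_le (hLb p hp).1) _
  obtain ⟨p0, hp0, hmin⟩ := isCompact_Icc.exists_isMinOn (nonempty_Icc.2 (zero_le_one' ℝ)) hcont
  obtain ⟨B, hB⟩ := isCompact_Icc.exists_bound_of_continuousOn hcont
  have hint : ∀ u ∈ Icc (0:ℝ) 1, ∀ v ∈ Icc (0:ℝ) 1,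
      IntervalIntegrable s MeasureTheory.volume u v := fun u hu v hv =>
    (hcont.mono (uIcc_subset_Icc hu hv)).intervalIntegrable
  have h01 : (0:ℝ) ∈ Icc (0:ℝ) 1 := by simp
  have hsub : ∀ u ∈ Icc (0:ℝ) 1, ∀ v ∈ Icc (0:ℝ) 1,
      Adef H L A0 v - Adef H L A0 u = ∫ w in u..v, s w := by
    intro u hu v hv
    unfold Adef
    rw [add_sub_add_left_eq_sub]
    exact intervalIntegral.integral_interval_sub_left (hint 0 h01 v hv) (hint 0 h01 u hu)
  set M : ℝ := A0 + |B| + 1 with hM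
  have hsm : ∀ p ∈ Icc (0:ℝ) 1, s p ∈ Icc (s p0) M := fun p hp => by
    refine ⟨hmin hp, ?_⟩
    have := (le_abs_self _).trans (hB p hp)
    have := le_abs_self B
    rw [hM]; linarith
  have hbd : ∀ u ∈ Icc (0:ℝ) 1, ∀ v ∈ Icc (0:ℝ) 1, u ≤ v → ∀ c d : ℝ,
      (∀ p ∈ Icc (0:ℝ) 1, s p ∈ Icc c d) →
      c * (v - u) ≤ Adef H L A0 v - Adef H L A0 u ∧
      Adef H L A0 v - Adef H L A0 u ≤ d * (v - u) := by
    intro u hu v hv huv c d hcd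
    rw [hsub u hu v hv]
    have hin : ∀ w ∈ Icc u v, w ∈ Icc (0:ℝ) 1 := fun w hw => ⟨hu.1.trans hw.1, hw.2.trans hv.2⟩
    have h1 := intervalIntegral.integral_mono_on huv (intervalIntegrable_const (c := c))
      (hint u hu v hv) (fun w hw => (hcd w (hin w hw)).1)
    have h2 := intervalIntegral.integral_mono_on huv (hint u hu v hv)
      (intervalIntegrable_const (c := d)) (fun w hw => (hcd w (hin w hw)).2)
    rw [intervalIntegral.integral_const, smul_eq_mul] at h1 h2
    constructor <;> linarith
  have hA00 : Adef H L A0 0 = A0 := by simp [Adef]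
  refine ⟨s p0, hpos p0 hp0, M, ?_, C, hC0, ?_, ?_⟩
  · rw [hM]; linarith [abs_nonneg B]
  · intro t ht
    have := hbd 0 h01 t ht ht.1 0 |B| (fun p hp => ⟨(hpos p hp).le,
      (le_abs_self _).trans ((hB p hp).trans (le_abs_self B))⟩)
    rw [hA00] at this
    have hb := abs_nonneg B
    refine ⟨by linarith, ?_⟩
    rw [hM]
    nlinarith [ht.2]
  · intro u hu t ht v hv hut htv huv
    have hd : 0 < v - u := sub_pos.2 huv
    have hb := hbd u hu v hv huv.le _ _ hsm
    refine ⟨(Adef H L A0 v - Adef H L A0 u) / (v - u), ⟨?_, ?_⟩, s t, hsm t ht, ?_, ?_, ?_⟩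
    · rw [le_div_iff₀ hd]; exact hb.1
    · rw [div_le_iff₀ hd]; exact hb.2
    · field_simp
    · have h1 := intervalIntegral.norm_integral_le_of_norm_le_const
        (f := fun w => s w - s t) (a := u) (b := v) (C := C * (v - u)) (by
          intro w hw
          rw [uIoc_of_le huv.le] at hw
          have hw' : w ∈ Icc (0:ℝ) 1 := ⟨hu.1.trans hw.1.le, hw.2.trans hv.2⟩
          refine (hlip w hw' t ht).trans (mul_le_mul_of_nonneg_left ?_ hC0)
          rw [abs_le]
          constructor <;> linarith [hw.1, hw.2])
      rw [intervalIntegral.integral_sub (hint u hu v hv) intervalIntegrable_const,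
        intervalIntegral.integral_const, ← hsub u hu v hv, smul_eq_mul, abs_of_pos hd,
        Real.norm_eq_abs] at h1
      have e : (Adef H L A0 v - Adef H L A0 u) / (v - u) - s t =
        (Adef H L A0 v - Adef H L A0 u - (v - u) * s t) / (v - u) := by field_simp
      rw [e, abs_div, abs_of_pos hd, div_le_iff₀ hd]
      exact h1
    · have hHt : 0 < H t := hHlo.trans_le (hHb t ht).1
      have hLt : 0 < L t := hLlo.trans_le (hLb t ht).1
      rw [hs]
      simp only
      rw [← Real.rpow_mul hLt.le, ← Real.rpow_two]
      congr 1
      field_simp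

theorem aux_delta (κ hi : ℝ) (hκ : 0 ≤ κ) (hhi : 0 < hi) : ∃ E ≥ (0:ℝ), ∀ d : ℝ, 0 < d →
    d ≤ 1 → ∀ r : ℝ, |r| ≤ κ * d → d ^ r ≤ E ∧ |d ^ r - 1| ≤ E * d ^ (1 - hi) := by
  obtain ⟨E, hE0, hE⟩ := aux_exp_bound κ
  refine ⟨Real.exp κ + E * (κ / hi), by positivity, fun d hd hd1 r hr => ?_⟩
  have hl1 := Real.abs_log_mul_self_lt d hd hd1
  have hl2 := Real.abs_log_mul_self_rpow_lt d hi hd hd1 hhi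
  rw [abs_mul, abs_of_pos hd] at hl1
  rw [abs_mul, abs_of_pos (Real.rpow_pos_of_pos hd hi)] at hl2
  have hg : 0 < d ^ (1 - hi) := Real.rpow_pos_of_pos hd _
  have hdd : d = d ^ hi * d ^ (1 - hi) := by
    rw [← Real.rpow_add hd]; simp
  have hw : |Real.log d * r| ≤ κ * (|Real.log d| * d) := by
    rw [abs_mul]
    nlinarith [mul_le_mul_of_nonneg_left hr (abs_nonneg (Real.log d))]
  have hwκ : |Real.log d * r| ≤ κ := hw.trans (by nlinarith)
  have hw2 : |Real.log d * r| ≤ κ / hi * d ^ (1 - hi) := by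
    refine hw.trans ?_
    calc κ * (|Real.log d| * d) = κ * (|Real.log d| * d ^ hi) * d ^ (1 - hi) := by
          rw [mul_assoc κ, mul_assoc |Real.log d|, ← hdd]
      _ ≤ κ * (1 / hi) * d ^ (1 - hi) := by gcongr
      _ = _ := by ring
  rw [Real.rpow_def_of_pos hd]
  constructor
  · have : Real.exp (Real.log d * r) ≤ Real.exp κ := Real.exp_le_exp.2 ((le_abs_self _).trans hwκ)
    have : 0 ≤ E * (κ / hi) := by positivity
    linarith
  · calc _ ≤ E * |Real.log d * r| := hE _ hwκ
      _ ≤ E * (κ / hi * d ^ (1 - hi)) := by gcongr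
      _ ≤ _ := by nlinarith [mul_pos (Real.exp_pos κ) hg]

/-- for the time-deformed multifractional Brownian motion the
variance is `A(t)^{2 H_t}` and the increment variance satisfies the local
regularity condition with exponent `H` and local Hölder constant `L`. -/
theorem stmt16 (H L : ℝ → ℝ) (κH κL : NNReal)
    (hHlip : LipschitzOnWith κH H (Icc (0:ℝ) 1))
    (hLlip : LipschitzOnWith κL L (Icc (0:ℝ) 1))
    (Hlo Hhi Llo Lhi : ℝ) (hHlo : 0 < Hlo) (hHhi : Hhi < 1) (hLlo : 0 < Llo)
    (hHb : ∀ t ∈ Icc (0:ℝ) 1, Hlo ≤ H t ∧ H t ≤ Hhi)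
    (hLb : ∀ t ∈ Icc (0:ℝ) 1, Llo ≤ L t ∧ L t ≤ Lhi)
    (A0 : ℝ) (hA0 : 0 ≤ A0) :
    (∀ t ∈ Icc (0:ℝ) 1, covA H L A0 t t = Adef H L A0 t ^ (2 * H t)) ∧
    (∃ Δ₀ > (0:ℝ), ∃ S ≥ (0:ℝ), ∃ β > (0:ℝ),
      ∀ u ∈ Icc (0:ℝ) 1, ∀ t ∈ Icc (0:ℝ) 1, ∀ v ∈ Icc (0:ℝ) 1,
        u ≤ t → t ≤ v → |u - v| ≤ Δ₀ →
        |(covA H L A0 u u + covA H L A0 v v - 2 * covA H L A0 u v) -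
            (L t) ^ 2 * |u - v| ^ (2 * H t)| ≤
          S * |u - v| ^ (2 * H t + 2 * β)) := by
  have hdiag : ∀ t ∈ Icc (0:ℝ) 1, covA H L A0 t t = Adef H L A0 t ^ (2 * H t) := by
    intro t ht
    have hHt : 0 < H t := hHlo.trans_le (hHb t ht).1
    unfold covA
    rw [Dnorm_self_s16 _ hHt ((hHb t ht).2.trans_lt hHhi), sub_self, abs_zero,
      Real.zero_rpow (by linarith), ← two_mul (H t)]
    ring
  refine ⟨hdiag, ?_⟩
  have h01 : (0:ℝ) ∈ Icc (0:ℝ) 1 := by simp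
  have hhi0 : 0 < Hhi := hHlo.trans_le ((hHb 0 h01).1.trans (hHb 0 h01).2)
  obtain ⟨m, hm, M, hM, C, hC0, hAM, hA⟩ := aux_A H L κH κL hHlip hLlip Hlo Hhi Llo Lhi hHlo hLlo
    hHb hLb A0 hA0
  have hM0 : (0:ℝ) ≤ M := by linarith
  obtain ⟨κ, hκ⟩ : ∃ κ : ℝ, κ = (κH : ℝ) := ⟨_, rfl⟩
  have hκ0 : 0 ≤ κ := hκ ▸ κH.2
  obtain ⟨C1, hC1, hI⟩ := aux_double M Hlo hM hHlo
  obtain ⟨C2, hC2, hII⟩ := aux_exp_lip M Hlo hM hHlo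
  obtain ⟨C3, hC3, hIII⟩ := aux_D Hlo Hhi hHlo hHhi
  obtain ⟨K, hK0, hK⟩ := aux_rpow_lip m M (2 * Hlo) 2 hm (by linarith)
  obtain ⟨E, hE0, hE⟩ := aux_delta (2 * κ) Hhi (by positivity) hhi0
  refine ⟨1, one_pos, C1 * (M * E) * κ + (C2 * κ) ^ 2 + C3 * κ ^ 2 * (3 * M ^ 2) +
    (M ^ 2 * E + K * (C + 2 * κ)), by positivity, (1 - Hhi) / 2, by linarith, ?_⟩
  intro u hu t ht v hv hut htv hd1
  have hx := hHb u hu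
  have hy := hHb v hv
  have hh := hHb t ht
  rcases eq_or_lt_of_le (hut.trans htv) with huv | huv
  · subst huv
    have : t = u := le_antisymm htv hut
    subst this
    rw [sub_self, abs_zero, Real.zero_rpow (by linarith), Real.zero_rpow (by linarith)]
    have : covA H L A0 t t + covA H L A0 t t - 2 * covA H L A0 t t = 0 := by ring
    rw [this]
    simp
  obtain ⟨ρ, hρ, σ, hσ, hinc, hρσ, hσL⟩ := hA u hu t ht v hv hut htv huv
  rw [hdiag u hu, hdiag v hv, ← hσL]
  rw [abs_sub_comm u v, abs_of_pos (sub_pos.2 huv)] at hd1 ⊢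
  have lipH : ∀ p ∈ Icc (0:ℝ) 1, ∀ q ∈ Icc (0:ℝ) 1, |p - q| ≤ v - u →
      |H p - H q| ≤ κ * (v - u) := by
    intro p hp q hq hpq
    have := hHlip.dist_le_mul p hp q hq
    rw [Real.dist_eq, Real.dist_eq, ← hκ] at this
    exact this.trans (mul_le_mul_of_nonneg_left hpq hκ0)
  have hxh := lipH u hu t ht (by rw [abs_le]; constructor <;> linarith)
  have hyh := lipH v hv t ht (by rw [abs_le]; constructor <;> linarith)
  have hxy := lipH u hu v hv (by rw [abs_le]; constructor <;> linarith)
  have hD := hIII (H u) hx (H v) hy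
  unfold covA
  have ha := hAM u hu
  have hb := hAM v hv
  rw [hinc]
  have hd : 0 < v - u := sub_pos.2 huv
  generalize Adef H L A0 u = a at *
  generalize Adef H L A0 v = b at *
  generalize H u = x at *
  generalize H v = y at *
  generalize H t = h at *
  generalize v - u = d at *
  generalize Dnorm x y = D at *
  have hρ0 : 0 < ρ := hm.trans_le hρ.1
  have hab : a ≤ b := by nlinarith [mul_pos hρ0 hd]
  rw [abs_of_pos (mul_pos hρ0 hd)]
  have hx' : x ∈ Icc Hlo 1 := ⟨hx.1, by linarith⟩
  have hy' : y ∈ Icc Hlo 1 := ⟨hy.1, by linarith⟩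
  set Q := d ^ (2 * h + 2 * ((1 - Hhi) / 2)) with hQ
  have hQ0 : 0 < Q := Real.rpow_pos_of_pos hd _
  have hpow : ∀ e : ℝ, 2 * h + (1 - Hhi) ≤ e → d ^ e ≤ Q := by
    intro e he
    exact Real.rpow_le_rpow_of_exponent_ge hd hd1 (by linarith)
  have hQ2 : d ^ 2 ≤ Q := by
    rw [← Real.rpow_two]; exact hpow 2 (by linarith)
  have hQ1 : d ^ h * d ≤ Q := by
    have : d ^ h * d = d ^ (h + 1) := by rw [Real.rpow_add hd, Real.rpow_one]
    rw [this]; exact hpow _ (by linarith)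
  have hQg : d ^ (2 * h) * d ^ (1 - Hhi) = Q := by
    rw [← Real.rpow_add hd, hQ]; congr 1; ring
  have hdg : d ≤ d ^ (1 - Hhi) := by
    conv_lhs => rw [← Real.rpow_one d]
    exact Real.rpow_le_rpow_of_exponent_ge hd hd1 (by linarith)
  have hpM : ∀ z ∈ Icc (0:ℝ) M, z ^ (x + y) ∈ Icc (0:ℝ) (M ^ 2) := by
    intro z hz
    refine ⟨Real.rpow_nonneg hz.1 _, ?_⟩
    calc z ^ (x + y) ≤ M ^ (x + y) := Real.rpow_le_rpow hz.1 hz.2 (by linarith)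
      _ ≤ M ^ (2:ℝ) := Real.rpow_le_rpow_of_exponent_le hM (by linarith)
      _ = M ^ 2 := Real.rpow_two M
  -- term I
  have b1 : |(b ^ (2 * x) - a ^ (2 * x)) - (b ^ (x + y) - a ^ (x + y))| ≤
      C1 * (M * E) * κ * Q := by
    have := hI a ha b hb hab x hx' y hy' (M * E * d ^ h) (by
      intro k hk
      have hkl : k ∈ Icc Hlo 1 := uIcc_subset_Icc hx' hy' hk
      have hkh : |k - h| ≤ 2 * κ * d := by
        have h3 : |k - h| ≤ κ * d := by
          rw [abs_le] at hxh hyh ⊢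
          rcases mem_uIcc.1 hk with h4 | h4 <;>
            constructor <;> linarith [h4.1, h4.2, hxh.1, hxh.2, hyh.1, hyh.2]
        nlinarith [mul_nonneg hκ0 hd.le]
      have hk1 := (hE d hd hd1 (k - h) hkh).1
      have hk2 := (aux_rpow_mem M hM ρ k ⟨hρ0.le, hρ.2⟩ (by linarith [hkl.1]) hkl.2)
      rw [hinc, Real.mul_rpow hρ0.le hd.le]
      have : d ^ k = d ^ (k - h) * d ^ h := by rw [← Real.rpow_add hd]; simp
      rw [this, ← mul_assoc]
      have hdk : 0 ≤ d ^ (k - h) := Real.rpow_nonneg hd.le _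
      have hdh : 0 ≤ d ^ h := Real.rpow_nonneg hd.le _
      exact mul_le_mul_of_nonneg_right (mul_le_mul hk2.2 hk1 hdk hM0) hdh)
    have hdh : 0 ≤ d ^ h := Real.rpow_nonneg hd.le _
    calc _ ≤ C1 * (M * E * d ^ h) * |x - y| := this
      _ ≤ C1 * (M * E * d ^ h) * (κ * d) := by gcongr
      _ = C1 * (M * E) * κ * (d ^ h * d) := by ring
      _ ≤ _ := by gcongr
  -- term II
  have b2 : |(b ^ x - b ^ y) ^ 2| ≤ (C2 * κ) ^ 2 * Q := by
    have h1 := (hII b hb x hx' y hy').trans (mul_le_mul_of_nonneg_left hxy hC2)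
    rw [abs_pow]
    calc _ ≤ (C2 * (κ * d)) ^ 2 := by gcongr
      _ = (C2 * κ) ^ 2 * d ^ 2 := by ring
      _ ≤ _ := by gcongr
  -- term III
  have b3 : |(2 * D - 1) * (a ^ (x + y) + b ^ (x + y) - (ρ * d) ^ (x + y))| ≤
      C3 * κ ^ 2 * (3 * M ^ 2) * Q := by
    have h1 : |2 * D - 1| ≤ C3 * κ ^ 2 * d ^ 2 := by
      have h2 : (x - y) ^ 2 ≤ (κ * d) ^ 2 := by
        rw [← sq_abs (x - y)]; gcongr
      calc _ ≤ C3 * (x - y) ^ 2 := hD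
        _ ≤ C3 * (κ * d) ^ 2 := by gcongr
        _ = _ := by ring
    have p1 := hpM a ha
    have p2 := hpM b hb
    have p3 := hpM (ρ * d) ⟨(mul_pos hρ0 hd).le, by linarith [hb.2, ha.1]⟩
    have h3 : |a ^ (x + y) + b ^ (x + y) - (ρ * d) ^ (x + y)| ≤ 3 * M ^ 2 := by
      rw [abs_le]
      constructor <;> linarith [p1.1, p1.2, p2.1, p2.2, p3.1, p3.2]
    rw [abs_mul]
    calc _ ≤ (C3 * κ ^ 2 * d ^ 2) * (3 * M ^ 2) := by gcongr
      _ = C3 * κ ^ 2 * (3 * M ^ 2) * d ^ 2 := by ring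
      _ ≤ _ := by gcongr
  -- term IV
  have b4 : |(ρ * d) ^ (x + y) - σ ^ (2 * h) * d ^ (2 * h)| ≤
      (M ^ 2 * E + K * (C + 2 * κ)) * Q := by
    have hs : |x + y - 2 * h| ≤ 2 * κ * d := by
      rw [abs_le] at hxh hyh ⊢
      constructor <;> linarith [hxh.1, hxh.2, hyh.1, hyh.2]
    have h1 := (hE d hd hd1 _ hs).2
    have h2 := (hK ρ hρ σ hσ (x + y) ⟨by linarith, by linarith⟩ (2 * h) ⟨by linarith, by linarith⟩).1
    have p1 := hpM ρ ⟨hρ0.le, hρ.2⟩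
    have e : (ρ * d) ^ (x + y) - σ ^ (2 * h) * d ^ (2 * h) =
        d ^ (2 * h) * (ρ ^ (x + y) * (d ^ (x + y - 2 * h) - 1) + (ρ ^ (x + y) - σ ^ (2 * h))) := by
      rw [Real.mul_rpow hρ0.le hd.le]
      have : d ^ (x + y) = d ^ (2 * h) * d ^ (x + y - 2 * h) := by
        rw [← Real.rpow_add hd]; congr 1; ring
      rw [this]; ring
    have hd2 : 0 < d ^ (2 * h) := Real.rpow_pos_of_pos hd _
    have hdγ : 0 < d ^ (1 - Hhi) := Real.rpow_pos_of_pos hd _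
    rw [e, abs_mul, abs_of_pos hd2, ← hQg]
    have h3 : |ρ ^ (x + y) * (d ^ (x + y - 2 * h) - 1)| ≤ M ^ 2 * (E * d ^ (1 - Hhi)) := by
      rw [abs_mul, abs_of_nonneg p1.1]
      exact mul_le_mul p1.2 h1 (abs_nonneg _) (by positivity)
    have h4 : |ρ ^ (x + y) - σ ^ (2 * h)| ≤ K * (C + 2 * κ) * d ^ (1 - Hhi) := by
      calc _ ≤ K * (|ρ - σ| + |x + y - 2 * h|) := h2
        _ ≤ K * (C * d + 2 * κ * d) := by gcongr
        _ = K * (C + 2 * κ) * d := by ring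
        _ ≤ _ := by gcongr
    calc _ ≤ d ^ (2 * h) * (M ^ 2 * (E * d ^ (1 - Hhi)) + K * (C + 2 * κ) * d ^ (1 - Hhi)) := by
          refine mul_le_mul_of_nonneg_left ?_ hd2.le
          exact (abs_add_le _ _).trans (add_le_add h3 h4)
      _ = _ := by ring
  have sqb : (b ^ x - b ^ y) ^ 2 = b ^ (2 * x) - 2 * b ^ (x + y) + b ^ (2 * y) := by
    rw [Real.rpow_add_of_nonneg hb.1 (by linarith) (by linarith), mul_comm 2 x, mul_comm 2 y,
      Real.rpow_mul hb.1, Real.rpow_mul hb.1, Real.rpow_two, Real.rpow_two]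
    ring
  rw [sqb] at b2
  rw [abs_le] at b1 b2 b3 b4 ⊢
  constructor <;> linarith [b1.1, b1.2, b2.1, b2.2, b3.1, b3.2, b4.1, b4.2]
end

section
/- Let H : [0,1] → (0,1), L : [0,1] → (0,∞) and m₂ : [0,1] → (0,∞) be Lipschitz continuous, with 0 < H̲ ≤ H̄ < 1, 0 < L̲ ≤ L̄ < ∞, and m₂ bounded away from 0 and ∞. Define A(t) = A(0)·exp( ∫₀ᵗ ( m₂(s)^{−1} L_s )^{1/H_s} ds ) with A(0) > 0, τ(t) = m₂(t)·A(t)^{−H_t}, and the kernel C_{A,τ}(s,t) = τ(s)·τ(t)·D(H_s, H_t)·[ A(s)^{H_s+H_t} + A(t)^{H_s+H_t} − |A(t) − A(s)|^{H_s+H_t} ] for s, t ∈ [0,1]. Then: (i) C_{A,τ}(t,t) = m₂(t)² for every t ∈ [0,1]; and (ii) the increment-variance function θ(u,v) = C_{A,τ}(u,u) + C_{A,τ}(v,v) − 2C_{A,τ}(u,v) satisfies the local regularity condition: there exist Δ₀ > 0, S ≥ 0 and β > 0 such that for all u ≤ t ≤ v in [0,1] with |u − v| ≤ Δ₀, | θ(u,v)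 − L_t²·|u − v|^{2H_t} | ≤ S·|u − v|^{2H_t + 2β}. -/
open Set

/-- The time deformation `A(t) = A(0)·exp(∫₀ᵗ (m₂(s)⁻¹ L_s)^{1/H_s} ds)`. -/
noncomputable def AdefExp (H L m2 : ℝ → ℝ) (A0 t : ℝ) : ℝ :=
  A0 * Real.exp (∫ s in (0:ℝ)..t, ((m2 s)⁻¹ * L s) ^ (1 / H s))

/-- The scaling function `τ(t) = m₂(t)·A(t)^{−H_t}`. -/
noncomputable def tauDef (H L m2 : ℝ → ℝ) (A0 t : ℝ) : ℝ :=
  m2 t * AdefExp H L m2 A0 t ^ (-(H t))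

/-- The kernel `C_{A,τ}` of the scaled, time-deformed multifractional Brownian
motion. -/
noncomputable def covATau (H L m2 : ℝ → ℝ) (A0 : ℝ) (s t : ℝ) : ℝ :=
  tauDef H L m2 A0 s * tauDef H L m2 A0 t * Dnorm (H s) (H t) *
    (AdefExp H L m2 A0 s ^ (H s + H t) + AdefExp H L m2 A0 t ^ (H s + H t) -
      |AdefExp H L m2 A0 t - AdefExp H L m2 A0 s| ^ (H s + H t))

theorem second_diff_s17 (F : ℝ → ℝ) (a b : ℝ) (U : Set ℝ) (hU : IsOpen U)
    (hF : ContDiffOn ℝ 2 F U) (hab : Icc a b ⊆ U) :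
    ∃ K : ℝ, 0 ≤ K ∧ ∀ p ∈ Icc a b, ∀ q ∈ Icc a b,
      |F p + F q - 2 * F ((p + q) / 2)| ≤ K * (p - q) ^ 2 := by
  have h1 : ContDiffOn ℝ 1 (deriv F) U :=
    ((contDiffOn_succ_iff_deriv_of_isOpen (n := 1) hU).1 (by simpa [one_add_one_eq_two] using hF)).2.2
  obtain ⟨K, hK⟩ := (h1.mono hab).exists_lipschitzOnWith one_ne_zero (convex_Icc a b) isCompact_Icc
  have hd : ∀ x ∈ Icc a b, HasDerivAt F (deriv F x) x := fun x hx =>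
    ((hF.differentiableOn (by norm_num)).differentiableAt (hU.mem_nhds (hab hx))).hasDerivAt
  have key : ∀ p ∈ Icc a b, ∀ q ∈ Icc a b, p ≤ q →
      |F p + F q - 2 * F ((p + q) / 2)| ≤ (K:ℝ) * (p - q) ^ 2 := by
    intro p hp q hq hpq
    set c := (p + q) / 2 with hc
    set h := (q - p) / 2 with hh
    have hin : ∀ s ∈ Icc 0 h, c + s ∈ Icc a b ∧ c - s ∈ Icc a b := by
      rintro s ⟨hs0, hs1⟩
      simp only [mem_Icc] at *
      refine ⟨⟨?_, ?_⟩, ?_, ?_⟩ <;> linarith [hp.1, hp.2, hq.1, hq.2]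
    have hder : ∀ s ∈ Icc 0 h, HasDerivAt (fun s => F (c + s) + F (c - s) - 2 * F c)
        (deriv F (c + s) - deriv F (c - s)) s := by
      intro s hs
      have e1 := HasDerivAt.comp_const_add c s (hd _ (hin s hs).1)
      have e2 := HasDerivAt.comp_const_sub c s (hd _ (hin s hs).2)
      simpa [sub_eq_add_neg] using (e1.add e2).sub_const (2 * F c)
    have := image_norm_le_of_norm_deriv_right_le_deriv_boundary (a := 0) (b := h)
      (f := fun s => F (c + s) + F (c - s) - 2 * F c)
      (f' := fun s => deriv F (c + s) - deriv F (c - s))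
      (B := fun s => K * s ^ 2) (B' := fun s => K * (2 * s))
      (fun s hs => (hder s hs).continuousAt.continuousWithinAt)
      (fun s hs => (hder s ⟨hs.1, hs.2.le⟩).hasDerivWithinAt)
      (by simp; ring_nf)
      (fun s => by simpa using ((hasDerivAt_pow 2 s).const_mul (K:ℝ)))
      (fun s hs => by
        have hs' : s ∈ Icc 0 h := ⟨hs.1, hs.2.le⟩
        have := hK.norm_sub_le (hin s hs').1 (hin s hs').2
        have h2 : c + s - (c - s) = 2 * s := by ring
        rw [h2, Real.norm_of_nonneg (by linarith [hs.1] : (0:ℝ) ≤ 2 * s)] at this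
        exact this)
      (show h ∈ Icc 0 h from ⟨by simp only [hh]; linarith, le_rfl⟩)
    have e1 : c + h = q := by simp only [hc, hh]; ring
    have e2 : c - h = p := by simp only [hc, hh]; ring
    simp only [e1, e2, Real.norm_eq_abs] at this
    rw [add_comm (F p)]
    refine this.trans ?_
    have : h ^ 2 ≤ (p - q) ^ 2 := by simp only [hh]; nlinarith [sq_nonneg (p - q)]
    exact mul_le_mul_of_nonneg_left this K.2
  refine ⟨K, K.2, fun p hp q hq => ?_⟩
  rcases le_total p q with h | h
  · exact key p hp q hq h
  · have := key q hq p hp h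
    rw [add_comm (F p), add_comm p q, show (p - q) ^ 2 = (q - p) ^ 2 by ring]
    exact this

theorem contDiffAt_realGamma {x : ℝ} (hx : 0 < x) : ContDiffAt ℝ 2 Real.Gamma x := by
  have hU : IsOpen {z : ℂ | 0 < z.re} := isOpen_lt continuous_const Complex.continuous_re
  have hd : DifferentiableOn ℂ Complex.Gamma {z : ℂ | 0 < z.re} := fun z hz => by
    refine (Complex.differentiableAt_Gamma z fun m hm => ?_).differentiableWithinAt
    rw [hm] at hz
    simp at hz
    have : (0:ℝ) ≤ m := m.cast_nonneg
    linarith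
  have h2 : ContDiffAt ℂ 2 Complex.Gamma (x : ℂ) :=
    (hd.contDiffOn hU).contDiffAt (hU.mem_nhds (by simpa using hx))
  exact h2.real_of_complex

theorem dnorm_exp (Hlo Hhi : ℝ) (h0 : 0 < Hlo) (h1 : Hhi < 1) :
    ∃ K : ℝ, 0 ≤ K ∧ ∀ x ∈ Icc Hlo Hhi, ∀ y ∈ Icc Hlo Hhi,
      ∃ d : ℝ, |d| ≤ K * (x - y) ^ 2 ∧ 2 * Dnorm x y = Real.exp d := by
  let F : ℝ → ℝ := fun z => Real.log (Real.Gamma (z + 1)) + Real.log (Real.sin (Real.pi * z / 2))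
  have hsin : ∀ z ∈ Ioo (0:ℝ) 2, 0 < Real.sin (Real.pi * z / 2) := fun z hz =>
    Real.sin_pos_of_pos_of_lt_pi (by have := Real.pi_pos; have := hz.1; positivity)
      (by nlinarith [Real.pi_pos, hz.2])
  have hG : ∀ z ∈ Ioo (0:ℝ) 2, 0 < Real.Gamma (z + 1) := fun z hz =>
    Real.Gamma_pos_of_pos (by linarith [hz.1])
  have hexp : ∀ z ∈ Ioo (0:ℝ) 2,
      Real.exp (F z) = Real.Gamma (z + 1) * Real.sin (Real.pi * z / 2) := fun z hz => by
    simp only [F]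
    rw [Real.exp_add, Real.exp_log (hG z hz), Real.exp_log (hsin z hz)]
  have hF : ContDiffOn ℝ 2 F (Ioo 0 2) := fun z hz => by
    apply ContDiffAt.contDiffWithinAt
    refine ContDiffAt.add (ContDiffAt.log ?_ (hG z hz).ne') (ContDiffAt.log ?_ (hsin z hz).ne')
    · exact ContDiffAt.comp (g := Real.Gamma) (f := fun z : ℝ => z + 1) z (contDiffAt_realGamma (by linarith [hz.1]))
        (contDiffAt_id.add contDiffAt_const)
    · exact (Real.contDiff_sin.comp ((contDiff_const.mul contDiff_id).div_const 2)).contDiffAt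
  obtain ⟨K, hK0, hK⟩ := second_diff_s17 F (2 * Hlo) (2 * Hhi) (Ioo 0 2) isOpen_Ioo hF
    (fun z hz => ⟨by linarith [hz.1], by linarith [hz.2]⟩)
  refine ⟨2 * K, by positivity, fun x hx y hy => ?_⟩
  refine ⟨(F (2 * x) + F (2 * y) - 2 * F ((2 * x + 2 * y) / 2)) / 2, ?_, ?_⟩
  · have := hK (2 * x) ⟨by linarith [hx.1], by linarith [hx.2]⟩ (2 * y)
      ⟨by linarith [hy.1], by linarith [hy.2]⟩
    rw [abs_div, abs_two]
    nlinarith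
  · have m1 : 2 * x ∈ Ioo (0:ℝ) 2 := ⟨by linarith [hx.1], by linarith [hx.2]⟩
    have m2 : 2 * y ∈ Ioo (0:ℝ) 2 := ⟨by linarith [hy.1], by linarith [hy.2]⟩
    have m3 : x + y ∈ Ioo (0:ℝ) 2 :=
      ⟨by linarith [hx.1, hy.1], by linarith [hx.2, hy.2]⟩
    have e : (2 * x + 2 * y) / 2 = x + y := by ring
    rw [e, show (F (2 * x) + F (2 * y) - 2 * F (x + y)) / 2
      = (F (2 * x) + F (2 * y)) / 2 - F (x + y) by ring, Real.exp_sub, Real.exp_half, Real.exp_add,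
      hexp _ m1, hexp _ m2, hexp _ m3]
    unfold Dnorm
    have s1 : Real.pi * (2 * x) / 2 = Real.pi * x := by ring
    have s2 : Real.pi * (2 * y) / 2 = Real.pi * y := by ring
    have := (hG _ m3).ne'
    have := (hsin _ m3).ne'
    rw [s1, s2]
    have s3 : Real.Gamma (2 * x + 1) * Real.sin (Real.pi * x) *
      (Real.Gamma (2 * y + 1) * Real.sin (Real.pi * y)) = Real.Gamma (2 * x + 1) *
      Real.Gamma (2 * y + 1) * Real.sin (Real.pi * x) * Real.sin (Real.pi * y) := by ring
    rw [s3]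
    field_simp

theorem log_lip {c a b : ℝ} (hc : 0 < c) (ha : c ≤ a) (hb : c ≤ b) :
    |Real.log a - Real.log b| ≤ |a - b| / c := by
  have key : ∀ a b : ℝ, c ≤ a → c ≤ b → Real.log a - Real.log b ≤ |a - b| / c := by
    intro a b ha hb
    have ha0 : 0 < a := hc.trans_le ha
    have hb0 : 0 < b := hc.trans_le hb
    rw [← Real.log_div ha0.ne' hb0.ne']
    have h1 := Real.log_le_sub_one_of_pos (div_pos ha0 hb0)
    have h2 : a / b - 1 = (a - b) / b := by field_simp
    rw [h2] at h1
    refine h1.trans ((div_le_div_of_nonneg_right (le_abs_self _) hb0.le).trans ?_)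
    exact div_le_div_of_nonneg_left (abs_nonneg _) hc hb
  rw [abs_le]
  constructor
  · have := key b a hb ha
    rw [abs_sub_comm] at this
    linarith
  · exact key a b ha hb

/-- The smooth part of the increment variance is of second order. -/
theorem est_one {p q x y d I δ κm κH Kd gm mhi Z : ℝ} (hδ0 : 0 ≤ δ) (hδ1 : δ ≤ 1)
    (hx0 : 0 ≤ x) (hx1 : x ≤ 1) (hy0 : 0 ≤ y) (hy1 : y ≤ 1)
    (hp0 : 0 ≤ p) (hp : p ≤ mhi) (hq0 : 0 ≤ q) (hq : q ≤ mhi)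
    (hpq : |p - q| ≤ κm * δ) (hxy : |x - y| ≤ κH * δ) (hKd : 0 ≤ Kd)
    (hd : |d| ≤ Kd * δ ^ 2) (hI0 : 0 ≤ I) (hI : I ≤ gm * δ) (hZ : Z = Kd + gm) (hZδ : Z * δ ≤ 1) :
    |p ^ 2 + q ^ 2 - p * q * (Real.exp (d - y * I) + Real.exp (d + x * I))| ≤
      (κm ^ 2 + mhi ^ 2 * (2 * Kd + κH * gm + 2 * Z ^ 2)) * δ ^ 2 := by
  have hδ2 : δ ^ 2 ≤ δ := by nlinarith
  have hd' : |d| ≤ Kd * δ := hd.trans (mul_le_mul_of_nonneg_left hδ2 hKd)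
  have hxI : |x * I| ≤ gm * δ := by
    rw [abs_of_nonneg (by positivity)]; nlinarith
  have hyI : |y * I| ≤ gm * δ := by
    rw [abs_of_nonneg (by positivity)]; nlinarith
  have hz1 : |d - y * I| ≤ Z * δ := (abs_sub _ _).trans (by rw [hZ]; linarith)
  have hz2 : |d + x * I| ≤ Z * δ := (abs_add_le _ _).trans (by rw [hZ]; linarith)
  have e1 := Real.abs_exp_sub_one_sub_id_le (hz1.trans hZδ)
  have e2 := Real.abs_exp_sub_one_sub_id_le (hz2.trans hZδ)
  have s1 : (d - y * I) ^ 2 ≤ Z ^ 2 * δ ^ 2 := by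
    rw [← mul_pow, ← sq_abs]; exact pow_le_pow_left₀ (abs_nonneg _) hz1 2
  have s2 : (d + x * I) ^ 2 ≤ Z ^ 2 * δ ^ 2 := by
    rw [← mul_pow, ← sq_abs]; exact pow_le_pow_left₀ (abs_nonneg _) hz2 2
  have hxyI : |(x - y) * I| ≤ κH * gm * δ ^ 2 := by
    rw [abs_mul, abs_of_nonneg hI0]
    calc |x - y| * I ≤ (κH * δ) * (gm * δ) :=
          mul_le_mul hxy hI hI0 ((abs_nonneg _).trans hxy)
      _ = _ := by ring
  have hT : |Real.exp (d - y * I) + Real.exp (d + x * I) - 2| ≤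
      (2 * Kd + κH * gm + 2 * Z ^ 2) * δ ^ 2 := by
    rw [abs_le] at e1 e2 hd hxyI ⊢
    constructor <;> nlinarith [e1.1, e1.2, e2.1, e2.2, hd.1, hd.2, hxyI.1, hxyI.2]
  have hpq2 : (p - q) ^ 2 ≤ κm ^ 2 * δ ^ 2 := by
    rw [← mul_pow, ← sq_abs]; exact pow_le_pow_left₀ (abs_nonneg _) hpq 2
  have hpqm : p * q ≤ mhi ^ 2 := by
    rw [sq]; exact mul_le_mul hp hq hq0 (hp0.trans hp)
  have hr : p ^ 2 + q ^ 2 - p * q * (Real.exp (d - y * I) + Real.exp (d + x * I)) =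
      (p - q) ^ 2 - p * q * (Real.exp (d - y * I) + Real.exp (d + x * I) - 2) := by ring
  rw [hr]
  refine (abs_sub _ _).trans ?_
  rw [abs_mul (p * q), abs_of_nonneg (sq_nonneg (p - q)), abs_of_nonneg (mul_nonneg hp0 hq0)]
  have := mul_le_mul hpqm hT (abs_nonneg _) (sq_nonneg mhi)
  linarith

/-- Logarithm of the rough part, compared with its target. -/
theorem est_log {p q m x y h d I G δ κm κH Kd KG MG gm mlo : ℝ} (hδ0 : 0 < δ) (hδ1 : δ ≤ 1)
    (hx0 : 0 ≤ x) (hx1 : x ≤ 1) (hy0 : 0 ≤ y) (hy1 : y ≤ 1)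
    (hmlo : 0 < mlo) (hp : mlo ≤ p) (hq : mlo ≤ q) (hm : mlo ≤ m)
    (hpm : |p - m| ≤ κm * δ) (hqm : |q - m| ≤ κm * δ)
    (hxh : |x - h| ≤ κH * δ) (hyh : |y - h| ≤ κH * δ) (hκH : 0 ≤ κH) (hKd : 0 ≤ Kd)
    (hκm : 0 ≤ κm) (hKG : 0 ≤ KG) (hMG : 0 ≤ MG)
    (hd : |d| ≤ Kd * δ ^ 2) (hI0 : 0 < I) (hI : I ≤ gm * δ) (hgm : 0 ≤ gm) (hG : |G| ≤ MG)
    (hI1 : Real.exp (G - KG * δ) * δ ≤ I) (hI2 : I ≤ Real.exp (G + KG * δ) * δ) :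
    |d + Real.log p + Real.log q - 2 * Real.log m - y * I + (x + y) * Real.log (Real.exp I - 1)
      - 2 * h * G - 2 * h * Real.log δ| ≤
      (Kd + 2 * κm / mlo + 3 * gm + 2 * KG + 2 * κH * MG + 4 * κH) * δ ^ (1/2:ℝ) := by
  set r := δ ^ (1/2:ℝ) with hr
  have hr0 : 0 < r := Real.rpow_pos_of_pos hδ0 _
  have hrr : r * r = δ := by
    rw [hr, ← Real.rpow_add hδ0]; norm_num
  have hr1 : r ≤ 1 := Real.rpow_le_one hδ0.le hδ1 (by norm_num)
  have hδr : δ ≤ r := by nlinarith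
  have hlogr : |Real.log δ| * δ ≤ 2 * r := by
    have := Real.abs_log_mul_self_rpow_lt δ (1/2) hδ0 hδ1 (by norm_num)
    rw [abs_mul, ← hr, abs_of_pos hr0] at this
    nlinarith
  have hδ2 : δ ^ 2 ≤ δ := by nlinarith
  have b1 : |d| ≤ Kd * r := hd.trans (mul_le_mul_of_nonneg_left (hδ2.trans hδr) hKd)
  have b2 : |Real.log p - Real.log m| ≤ κm / mlo * r := by
    refine (log_lip hmlo hp hm).trans ?_
    rw [div_mul_eq_mul_div]
    exact div_le_div_of_nonneg_right (hpm.trans (mul_le_mul_of_nonneg_left hδr hκm)) hmlo.le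
  have b3 : |Real.log q - Real.log m| ≤ κm / mlo * r := by
    refine (log_lip hmlo hq hm).trans ?_
    rw [div_mul_eq_mul_div]
    exact div_le_div_of_nonneg_right (hqm.trans (mul_le_mul_of_nonneg_left hδr hκm)) hmlo.le
  have hIr : I ≤ gm * r := hI.trans (mul_le_mul_of_nonneg_left hδr hgm)
  have b4 : |y * I| ≤ gm * r := by
    rw [abs_of_nonneg (by positivity)]; nlinarith
  have hE : I ≤ Real.exp I - 1 := by linarith [Real.add_one_le_exp I]
  have hE0 : 0 < Real.exp I - 1 := hI0.trans_le hE
  have hE2 : Real.exp I - 1 ≤ I * Real.exp I := by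
    have h1 := Real.add_one_le_exp (-I)
    have h2 : Real.exp (-I) * Real.exp I = 1 := by rw [← Real.exp_add]; simp
    nlinarith [Real.exp_pos I]
  have l1 : Real.log I ≤ Real.log (Real.exp I - 1) := Real.log_le_log hI0 hE
  have l2 : Real.log (Real.exp I - 1) ≤ Real.log I + I := by
    have := Real.log_le_log hE0 hE2
    rwa [Real.log_mul hI0.ne' (Real.exp_pos I).ne', Real.log_exp] at this
  have l3 : G - KG * δ + Real.log δ ≤ Real.log I := by
    have := Real.log_le_log (by positivity) hI1
    rwa [Real.log_mul (Real.exp_pos _).ne' hδ0.ne', Real.log_exp] at this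
  have l4 : Real.log I ≤ G + KG * δ + Real.log δ := by
    have := Real.log_le_log hI0 hI2
    rwa [Real.log_mul (Real.exp_pos _).ne' hδ0.ne', Real.log_exp] at this
  have hKr : KG * δ ≤ KG * r := mul_le_mul_of_nonneg_left hδr hKG
  have b5' : |Real.log (Real.exp I - 1) - Real.log δ - G| ≤ (gm + KG) * r := by
    rw [add_mul, abs_le]; constructor <;> linarith
  have b5 : |(x + y) * (Real.log (Real.exp I - 1) - Real.log δ - G)| ≤ 2 * ((gm + KG) * r) := by
    rw [abs_mul, abs_of_nonneg (by positivity : 0 ≤ x + y)]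
    exact mul_le_mul (by linarith) b5' (abs_nonneg _) (by norm_num)
  have b6 : |(x + y - 2 * h) * (G + Real.log δ)| ≤ (2 * κH * MG + 4 * κH) * r := by
    have c1 : |x + y - 2 * h| ≤ 2 * κH * δ := by
      rw [show x + y - 2 * h = (x - h) + (y - h) by ring]
      exact (abs_add_le _ _).trans (by linarith)
    have c2 : |G + Real.log δ| ≤ MG + |Real.log δ| := (abs_add_le _ _).trans (by linarith)
    rw [abs_mul]
    refine (mul_le_mul c1 c2 (abs_nonneg _) (by positivity)).trans ?_
    have t1 : 2 * κH * MG * δ ≤ 2 * κH * MG * r := mul_le_mul_of_nonneg_left hδr (by positivity)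
    have t2 : 2 * κH * (|Real.log δ| * δ) ≤ 2 * κH * (2 * r) :=
      mul_le_mul_of_nonneg_left hlogr (by positivity)
    linarith
  have hsplit : d + Real.log p + Real.log q - 2 * Real.log m - y * I
      + (x + y) * Real.log (Real.exp I - 1) - 2 * h * G - 2 * h * Real.log δ =
      d + (Real.log p - Real.log m) + (Real.log q - Real.log m) - y * I
      + (x + y) * (Real.log (Real.exp I - 1) - Real.log δ - G)
      + (x + y - 2 * h) * (G + Real.log δ) := by ring
  rw [hsplit]
  have hdiv : 2 * κm / mlo = 2 * (κm / mlo) := by ring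
  rw [hdiv]
  have t1 := abs_add_le (d + (Real.log p - Real.log m) + (Real.log q - Real.log m) - y * I
      + (x + y) * (Real.log (Real.exp I - 1) - Real.log δ - G))
      ((x + y - 2 * h) * (G + Real.log δ))
  have t2 := abs_add_le (d + (Real.log p - Real.log m) + (Real.log q - Real.log m) - y * I)
      ((x + y) * (Real.log (Real.exp I - 1) - Real.log δ - G))
  have t3 := abs_sub (d + (Real.log p - Real.log m) + (Real.log q - Real.log m)) (y * I)
  have t4 := abs_add_le (d + (Real.log p - Real.log m)) (Real.log q - Real.log m)
  have t5 := abs_add_le d (Real.log p - Real.log m)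
  linarith

theorem est_two {p q m x y h d I G δ C : ℝ} (hδ0 : 0 < δ)
    (hp : 0 < p) (hq : 0 < q) (hm : 0 < m) (hI0 : 0 < I)
    (hw : |d + Real.log p + Real.log q - 2 * Real.log m - y * I
      + (x + y) * Real.log (Real.exp I - 1) - 2 * h * G - 2 * h * Real.log δ| ≤
      C * δ ^ (1/2:ℝ)) (hC : C * δ ^ (1/2:ℝ) ≤ 1) :
    |p * q * (Real.exp d * Real.exp (-(y * I)) * (Real.exp I - 1) ^ (x + y)) -
      (m * Real.exp (h * G)) ^ 2 * δ ^ (2 * h)| ≤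
      (m * Real.exp (h * G)) ^ 2 * δ ^ (2 * h) * (2 * (C * δ ^ (1/2:ℝ))) := by
  set w := d + Real.log p + Real.log q - 2 * Real.log m - y * I
      + (x + y) * Real.log (Real.exp I - 1) - 2 * h * G - 2 * h * Real.log δ with hwd
  have hE0 : 0 < Real.exp I - 1 := by linarith [Real.add_one_le_exp I]
  set T := (m * Real.exp (h * G)) ^ 2 * δ ^ (2 * h) with hT
  have hT0 : 0 < T := by positivity
  have hTe : T = Real.exp (2 * Real.log m + 2 * h * G + 2 * h * Real.log δ) := by
    rw [Real.exp_add, Real.exp_add, hT, Real.rpow_def_of_pos hδ0,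
      show 2 * Real.log m = Real.log m + Real.log m by ring, Real.exp_add, Real.exp_log hm,
      show 2 * h * G = h * G + h * G by ring, Real.exp_add,
      show Real.log δ * (2 * h) = 2 * h * Real.log δ by ring]
    ring
  have hM : p * q * (Real.exp d * Real.exp (-(y * I)) * (Real.exp I - 1) ^ (x + y)) =
      T * Real.exp w := by
    rw [hTe, ← Real.exp_add, Real.rpow_def_of_pos hE0]
    nth_rewrite 1 [← Real.exp_log hp]
    nth_rewrite 1 [← Real.exp_log hq]
    simp only [← Real.exp_add]
    congr 1
    rw [hwd]; ring
  rw [hM, show T * Real.exp w - T = T * (Real.exp w - 1) by ring, abs_mul, abs_of_pos hT0]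
  refine mul_le_mul_of_nonneg_left ?_ hT0.le
  exact (Real.abs_exp_sub_one_le (hw.trans hC)).trans (by linarith)

theorem cov_formula {p q x y a b D d I : ℝ} (ha : 0 < a) (hb : b = a * Real.exp I)
    (hI : 0 ≤ I) (hD : 2 * D = Real.exp d) :
    2 * (p * a ^ (-x) * (q * b ^ (-y)) * D *
      (a ^ (x + y) + b ^ (x + y) - |b - a| ^ (x + y))) =
    p * q * (Real.exp (d - y * I) + Real.exp (d + x * I)) -
      p * q * (Real.exp d * Real.exp (-(y * I)) * (Real.exp I - 1) ^ (x + y)) := by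
  obtain ⟨α, rfl⟩ : ∃ α, a = Real.exp α := ⟨Real.log a, (Real.exp_log ha).symm⟩
  have hE : 0 ≤ Real.exp I - 1 := by linarith [Real.add_one_le_exp I]
  have h1 : |b - Real.exp α| = Real.exp α * (Real.exp I - 1) := by
    rw [hb, show Real.exp α * Real.exp I - Real.exp α = Real.exp α * (Real.exp I - 1) by ring,
      abs_of_nonneg (by positivity)]
  rw [h1, Real.mul_rpow (Real.exp_pos α).le hE, hb, ← Real.exp_add]
  simp only [← Real.exp_mul]
  generalize (Real.exp I - 1) ^ (x + y) = W
  have h2 : D = Real.exp d / 2 := by linarith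
  have e1 : Real.exp (d - y * I) = Real.exp (α * -x) * Real.exp ((α + I) * -y) * Real.exp d *
      Real.exp (α * (x + y)) := by
    simp only [← Real.exp_add]; congr 1; ring
  have e2 : Real.exp (d + x * I) = Real.exp (α * -x) * Real.exp ((α + I) * -y) * Real.exp d *
      Real.exp ((α + I) * (x + y)) := by
    simp only [← Real.exp_add]; congr 1; ring
  have e3 : Real.exp d * Real.exp (-(y * I)) =
      Real.exp (α * -x) * Real.exp ((α + I) * -y) * Real.exp d * Real.exp (α * (x + y)) := by
    simp only [← Real.exp_add]; congr 1; ring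
  rw [e1, e2, e3, h2]
  ring

theorem G_props (H L m2 : ℝ → ℝ) (κH κL κm : NNReal)
    (hHlip : LipschitzOnWith κH H (Icc (0:ℝ) 1))
    (hLlip : LipschitzOnWith κL L (Icc (0:ℝ) 1))
    (hmlip : LipschitzOnWith κm m2 (Icc (0:ℝ) 1))
    (Hlo Llo mlo : ℝ) (hHlo : 0 < Hlo) (hLlo : 0 < Llo) (hmlo : 0 < mlo)
    (hHb : ∀ t ∈ Icc (0:ℝ) 1, Hlo ≤ H t)
    (hLb : ∀ t ∈ Icc (0:ℝ) 1, Llo ≤ L t)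
    (hmb : ∀ t ∈ Icc (0:ℝ) 1, mlo ≤ m2 t) :
    ∃ G : ℝ → ℝ, ∃ KG MG : ℝ, 0 ≤ KG ∧ 0 ≤ MG ∧
      (∀ s ∈ Icc (0:ℝ) 1, ∀ t ∈ Icc (0:ℝ) 1, |G s - G t| ≤ KG * |s - t|) ∧
      (∀ s ∈ Icc (0:ℝ) 1, |G s| ≤ MG) ∧
      (∀ s ∈ Icc (0:ℝ) 1, ((m2 s)⁻¹ * L s) ^ (1 / H s) = Real.exp (G s)) ∧
      (∀ s ∈ Icc (0:ℝ) 1, L s = m2 s * Real.exp (H s * G s)) := by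
  let N : ℝ → ℝ := fun s => Real.log (L s) - Real.log (m2 s)
  have z0 : (0:ℝ) ∈ Icc (0:ℝ) 1 := by simp
  set KN : ℝ := κL / Llo + κm / mlo with hKN
  have hKN0 : 0 ≤ KN := by positivity
  have hN : ∀ s ∈ Icc (0:ℝ) 1, ∀ t ∈ Icc (0:ℝ) 1, |N s - N t| ≤ KN * |s - t| := by
    intro s hs t ht
    have h1 := log_lip hLlo (hLb s hs) (hLb t ht)
    have h2 := log_lip hmlo (hmb s hs) (hmb t ht)
    have h3 := hLlip.norm_sub_le hs ht
    have h4 := hmlip.norm_sub_le hs ht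
    simp only [Real.norm_eq_abs] at h3 h4
    have h5 := h1.trans (div_le_div_of_nonneg_right h3 hLlo.le)
    have h6 := h2.trans (div_le_div_of_nonneg_right h4 hmlo.le)
    have h7 : N s - N t = (Real.log (L s) - Real.log (L t)) -
      (Real.log (m2 s) - Real.log (m2 t)) := by simp only [N]; ring
    rw [h7]
    refine (abs_sub _ _).trans ?_
    have h8 : KN * |s - t| = κL * |s - t| / Llo + κm * |s - t| / mlo := by rw [hKN]; ring
    linarith
  set BN : ℝ := |N 0| + KN with hBN
  have hBN0 : 0 ≤ BN := by positivity
  have hNb : ∀ s ∈ Icc (0:ℝ) 1, |N s| ≤ BN := by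
    intro s hs
    have h1 := hN s hs 0 z0
    have h2 : |s - 0| ≤ 1 := by rw [sub_zero, abs_of_nonneg hs.1]; exact hs.2
    have h3 := abs_add_le (N s - N 0) (N 0)
    rw [sub_add_cancel] at h3
    have h4 := mul_le_mul_of_nonneg_left h2 hKN0
    linarith
  refine ⟨fun s => N s / H s, KN / Hlo + BN * κH / (Hlo * Hlo), BN / Hlo, by positivity,
    by positivity, ?_, ?_, ?_, ?_⟩
  · intro s hs t ht
    have hs0 : 0 < H s := hHlo.trans_le (hHb s hs)
    have ht0 : 0 < H t := hHlo.trans_le (hHb t ht)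
    have e : N s / H s - N t / H t = (N s - N t) / H s + N t * (H t - H s) / (H s * H t) := by
      field_simp; ring
    have h3 := hHlip.norm_sub_le hs ht
    simp only [Real.norm_eq_abs] at h3
    rw [abs_sub_comm] at h3
    change |N s / H s - N t / H t| ≤ _
    rw [e]
    refine (abs_add_le _ _).trans ?_
    rw [abs_div, abs_div, abs_mul, abs_of_pos hs0, abs_of_pos (mul_pos hs0 ht0), add_mul]
    refine add_le_add ?_ ?_
    · rw [div_mul_eq_mul_div]
      exact div_le_div₀ (by positivity) (hN s hs t ht) hHlo (hHb s hs)
    · rw [div_mul_eq_mul_div, mul_assoc BN]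
      exact div_le_div₀ (by positivity)
        (mul_le_mul (hNb t ht) h3 (abs_nonneg _) hBN0) (by positivity)
        (mul_le_mul (hHb s hs) (hHb t ht) hHlo.le hs0.le)
  · intro s hs
    have hs0 : 0 < H s := hHlo.trans_le (hHb s hs)
    change |N s / H s| ≤ _
    rw [abs_div, abs_of_pos hs0]
    exact div_le_div₀ hBN0 (hNb s hs) hHlo (hHb s hs)
  · intro s hs
    have hs0 : 0 < H s := hHlo.trans_le (hHb s hs)
    have hL0 : 0 < L s := hLlo.trans_le (hLb s hs)
    have hm0 : 0 < m2 s := hmlo.trans_le (hmb s hs)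
    rw [Real.rpow_def_of_pos (by positivity), Real.log_mul (by positivity) hL0.ne', Real.log_inv]
    congr 1
    simp only [N]; ring
  · intro s hs
    have hs0 : 0 < H s := hHlo.trans_le (hHb s hs)
    have hL0 : 0 < L s := hLlo.trans_le (hLb s hs)
    have hm0 : 0 < m2 s := hmlo.trans_le (hmb s hs)
    change L s = m2 s * Real.exp (H s * (N s / H s))
    rw [mul_div_cancel₀ _ hs0.ne']
    simp only [N]
    rw [Real.exp_sub, Real.exp_log hL0, Real.exp_log hm0]
    field_simp

theorem A_step (H L m2 G : ℝ → ℝ) (A0 KG : ℝ) (hKG : 0 ≤ KG)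
    (hGl : ∀ s ∈ Icc (0:ℝ) 1, ∀ t ∈ Icc (0:ℝ) 1, |G s - G t| ≤ KG * |s - t|)
    (hg : ∀ s ∈ Icc (0:ℝ) 1, ((m2 s)⁻¹ * L s) ^ (1 / H s) = Real.exp (G s))
    (u v : ℝ) (hu : u ∈ Icc (0:ℝ) 1) (hv : v ∈ Icc (0:ℝ) 1) (huv : u ≤ v) :
    ∃ I : ℝ, AdefExp H L m2 A0 v = AdefExp H L m2 A0 u * Real.exp I ∧
      ∀ t ∈ Icc u v, Real.exp (G t - KG * (v - u)) * (v - u) ≤ I ∧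
        I ≤ Real.exp (G t + KG * (v - u)) * (v - u) := by
  set f : ℝ → ℝ := fun s => ((m2 s)⁻¹ * L s) ^ (1 / H s) with hf
  have hGc : ContinuousOn G (Icc (0:ℝ) 1) := by
    have : LipschitzOnWith ⟨KG, hKG⟩ G (Icc (0:ℝ) 1) :=
      LipschitzOnWith.of_dist_le_mul fun s hs t ht => by
        rw [Real.dist_eq, Real.dist_eq]; exact hGl s hs t ht
    exact this.continuousOn
  have hfc : ContinuousOn f (Icc (0:ℝ) 1) := (Real.continuous_exp.comp_continuousOn hGc).congr hg
  have hint : ∀ a ∈ Icc (0:ℝ) 1, ∀ b ∈ Icc (0:ℝ) 1, IntervalIntegrable f MeasureTheory.volume a b :=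
    fun a ha b hb => (hfc.mono (uIcc_subset_Icc ha hb)).intervalIntegrable
  have z0 : (0:ℝ) ∈ Icc (0:ℝ) 1 := by simp
  refine ⟨∫ s in u..v, f s, ?_, ?_⟩
  · unfold AdefExp
    rw [mul_assoc, ← Real.exp_add]
    congr 2
    exact (intervalIntegral.integral_add_adjacent_intervals (hint 0 z0 u hu) (hint u hu v hv)).symm
  · intro t ht
    have ht1 : t ∈ Icc (0:ℝ) 1 := ⟨hu.1.trans ht.1, ht.2.trans hv.2⟩
    have hb : ∀ s ∈ Icc u v, G t - KG * (v - u) ≤ G s ∧ G s ≤ G t + KG * (v - u) := by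
      intro s hs
      have hs1 : s ∈ Icc (0:ℝ) 1 := ⟨hu.1.trans hs.1, hs.2.trans hv.2⟩
      have h1 := hGl s hs1 t ht1
      have h2 : |s - t| ≤ v - u := by
        rw [abs_le]; constructor <;> linarith [hs.1, hs.2, ht.1, ht.2]
      have h3 := abs_le.1 (h1.trans (mul_le_mul_of_nonneg_left h2 hKG))
      constructor <;> linarith [h3.1, h3.2]
    have hfs : ∀ s ∈ Icc u v, f s = Real.exp (G s) := fun s hs =>
      hg s ⟨hu.1.trans hs.1, hs.2.trans hv.2⟩
    constructor
    · have := intervalIntegral.integral_mono_on huv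
        (intervalIntegrable_const (c := Real.exp (G t - KG * (v - u)))) (hint u hu v hv)
        (fun s hs => by rw [hfs s hs]; exact Real.exp_le_exp.2 (hb s hs).1)
      rw [intervalIntegral.integral_const, smul_eq_mul, mul_comm] at this
      exact this
    · have := intervalIntegral.integral_mono_on huv (hint u hu v hv)
        (intervalIntegrable_const (c := Real.exp (G t + KG * (v - u))))
        (fun s hs => by rw [hfs s hs]; exact Real.exp_le_exp.2 (hb s hs).2)
      rw [intervalIntegral.integral_const, smul_eq_mul, mul_comm (v - u)] at this
      exact this

/-- the scaled, time-deformed multifractional Brownian motion has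
variance `m₂(t)²` and its increment variance satisfies the local regularity
condition with exponent `H` and local Hölder constant `L`. -/
theorem stmt17 (H L m2 : ℝ → ℝ) (κH κL κm : NNReal)
    (hHlip : LipschitzOnWith κH H (Icc (0:ℝ) 1))
    (hLlip : LipschitzOnWith κL L (Icc (0:ℝ) 1))
    (hmlip : LipschitzOnWith κm m2 (Icc (0:ℝ) 1))
    (Hlo Hhi Llo Lhi mlo mhi : ℝ)
    (hHlo : 0 < Hlo) (hHhi : Hhi < 1) (hLlo : 0 < Llo) (hmlo : 0 < mlo)
    (hHb : ∀ t ∈ Icc (0:ℝ) 1, Hlo ≤ H t ∧ H t ≤ Hhi)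
    (hLb : ∀ t ∈ Icc (0:ℝ) 1, Llo ≤ L t ∧ L t ≤ Lhi)
    (hmb : ∀ t ∈ Icc (0:ℝ) 1, mlo ≤ m2 t ∧ m2 t ≤ mhi)
    (A0 : ℝ) (hA0 : 0 < A0) :
    (∀ t ∈ Icc (0:ℝ) 1, covATau H L m2 A0 t t = (m2 t) ^ 2) ∧
    (∃ Δ₀ > (0:ℝ), ∃ S ≥ (0:ℝ), ∃ β > (0:ℝ),
      ∀ u ∈ Icc (0:ℝ) 1, ∀ t ∈ Icc (0:ℝ) 1, ∀ v ∈ Icc (0:ℝ) 1,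
        u ≤ t → t ≤ v → |u - v| ≤ Δ₀ →
        |(covATau H L m2 A0 u u + covATau H L m2 A0 v v -
              2 * covATau H L m2 A0 u v) -
            (L t) ^ 2 * |u - v| ^ (2 * H t)| ≤
          S * |u - v| ^ (2 * H t + 2 * β)) := by
  obtain ⟨K, hK0, hK⟩ := dnorm_exp Hlo Hhi hHlo hHhi
  obtain ⟨G, KG, MG, hKG, hMG, hGl, hGb, hg, hLG⟩ := G_props H L m2 κH κL κm hHlip hLlip hmlip
    Hlo Llo mlo hHlo hLlo hmlo (fun t ht => (hHb t ht).1) (fun t ht => (hLb t ht).1)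
    (fun t ht => (hmb t ht).1)
  have hApos : ∀ t, 0 < AdefExp H L m2 A0 t := fun t => mul_pos hA0 (Real.exp_pos _)
  have hdiag : ∀ t ∈ Icc (0:ℝ) 1, covATau H L m2 A0 t t = (m2 t) ^ 2 := by
    intro t ht
    obtain ⟨d, hd, hD⟩ := hK (H t) (hHb t ht) (H t) (hHb t ht)
    have hd0 : d = 0 := by
      rw [sub_self] at hd
      simpa using hd
    subst hd0
    have hx : 0 < H t := hHlo.trans_le (hHb t ht).1
    have := cov_formula (p := m2 t) (q := m2 t) (x := H t) (y := H t) (hApos t)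
      (b := AdefExp H L m2 A0 t) (I := 0) (by simp) le_rfl hD
    simp only [mul_zero, sub_zero, Real.exp_zero, sub_self, add_zero,
      Real.zero_rpow (by linarith : H t + H t ≠ 0)] at this
    unfold covATau tauDef
    simp only [sub_self]
    linarith
  refine ⟨hdiag, ?_⟩
  set gm : ℝ := Real.exp (MG + KG) with hgm
  set Kd : ℝ := K * κH ^ 2 with hKd
  set Z : ℝ := Kd + gm with hZ
  set C1 : ℝ := κm ^ 2 + mhi ^ 2 * (2 * Kd + κH * gm + 2 * Z ^ 2) with hC1
  set C2 : ℝ := Kd + 2 * κm / mlo + 3 * gm + 2 * KG + 2 * κH * MG + 4 * κH with hC2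
  have hgm0 : 0 < gm := Real.exp_pos _
  have hKd0 : 0 ≤ Kd := by positivity
  have hZ0 : 0 ≤ Z := by positivity
  have hC10 : 0 ≤ C1 := by positivity
  have hC20 : 0 ≤ C2 := by positivity
  clear_value C1 C2 Z Kd gm
  set Q : ℝ := Z + C2 + 1 with hQ
  have hQ1 : 1 ≤ Q := by linarith
  have hQ0 : 0 < Q := by linarith
  set β : ℝ := min (1 - Hhi) (1/4) with hβ
  have hβ0 : 0 < β := lt_min (by linarith) (by norm_num)
  have hβ1 : β ≤ 1 - Hhi := min_le_left _ _
  have hβ2 : β ≤ 1/4 := min_le_right _ _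
  refine ⟨(1 / Q) ^ 2, by positivity, C1 + Lhi ^ 2 * (2 * C2), by positivity, β, hβ0, ?_⟩
  intro u hu t ht v hv hut htv hΔ
  have huv : u ≤ v := hut.trans htv
  have hht0 : 0 < H t := hHlo.trans_le (hHb t ht).1
  have habs : |u - v| = v - u := by rw [abs_sub_comm, abs_of_nonneg (by linarith)]
  rw [habs] at hΔ ⊢
  rw [hdiag u hu, hdiag v hv]
  rcases huv.eq_or_lt with h | huv'
  · subst h
    rw [hdiag u hu, sub_self, Real.zero_rpow (by linarith), Real.zero_rpow (by linarith)]
    simp [two_mul]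
  set δ := v - u with hδ
  have hδ0 : 0 < δ := by linarith
  have hδ1 : δ ≤ 1 := by linarith [hu.1, hv.2]
  set r := δ ^ (1/2:ℝ) with hr
  have hr0 : 0 < r := Real.rpow_pos_of_pos hδ0 _
  have hrr : r * r = δ := by
    rw [hr, ← Real.rpow_add hδ0]; norm_num
  have hrQ : r ≤ 1 / Q := by
    rw [← hrr, ← sq] at hΔ
    exact (pow_le_pow_iff_left₀ hr0.le (by positivity) two_ne_zero).1 hΔ
  have hrQ' : Q * r ≤ 1 := by
    rw [le_div_iff₀ hQ0] at hrQ; linarith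
  have hδr : δ ≤ r := by
    have : r ≤ 1 := Real.rpow_le_one hδ0.le hδ1 (by norm_num)
    nlinarith
  have hZδ : Z * δ ≤ 1 := by
    have h1 : Z * δ ≤ Z * r := mul_le_mul_of_nonneg_left hδr hZ0
    have h2 : Z * r ≤ Q * r := mul_le_mul_of_nonneg_right (by linarith) hr0.le
    linarith
  have hCr : C2 * r ≤ 1 := by
    have h2 : C2 * r ≤ Q * r := mul_le_mul_of_nonneg_right (by linarith) hr0.le
    linarith
  have dist_le : ∀ (f : ℝ → ℝ) (κ : NNReal), LipschitzOnWith κ f (Icc (0:ℝ) 1) →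
      ∀ a ∈ Icc u v, ∀ b ∈ Icc u v, |f a - f b| ≤ κ * δ := by
    intro f κ hf a ha b hb
    have h1 := hf.norm_sub_le (x := a) (y := b) ⟨hu.1.trans ha.1, ha.2.trans hv.2⟩
      ⟨hu.1.trans hb.1, hb.2.trans hv.2⟩
    simp only [Real.norm_eq_abs] at h1
    refine h1.trans (mul_le_mul_of_nonneg_left ?_ κ.2)
    rw [abs_le]; constructor <;> linarith [ha.1, ha.2, hb.1, hb.2]
  have mu : u ∈ Icc u v := ⟨le_rfl, huv⟩
  have mv : v ∈ Icc u v := ⟨huv, le_rfl⟩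
  have mt : t ∈ Icc u v := ⟨hut, htv⟩
  obtain ⟨I, hA, hIb⟩ := A_step H L m2 G A0 KG hKG hGl hg u v hu hv huv
  obtain ⟨hI1, hI2⟩ := hIb t mt
  rw [← hδ] at hI1 hI2
  have hI0 : 0 < I := lt_of_lt_of_le (by positivity) hI1
  have hIg : I ≤ gm * δ := by
    rw [hgm]
    refine hI2.trans (mul_le_mul_of_nonneg_right (Real.exp_le_exp.2 ?_) hδ0.le)
    have := (abs_le.1 (hGb t ht)).2
    have h2 : KG * δ ≤ KG * 1 := mul_le_mul_of_nonneg_left hδ1 hKG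
    linarith
  obtain ⟨d, hd, hD⟩ := hK (H u) (hHb u hu) (H v) (hHb v hv)
  have hxy := dist_le H κH hHlip u mu v mv
  have hd' : |d| ≤ Kd * δ ^ 2 := by
    refine hd.trans ?_
    rw [hKd, mul_assoc, ← mul_pow, ← sq_abs]
    exact mul_le_mul_of_nonneg_left (pow_le_pow_left₀ (abs_nonneg _) hxy 2) hK0
  have hx0 : 0 ≤ H u := hHlo.le.trans (hHb u hu).1
  have hx1 : H u ≤ 1 := (hHb u hu).2.trans hHhi.le
  have hy0 : 0 ≤ H v := hHlo.le.trans (hHb v hv).1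
  have hy1 : H v ≤ 1 := (hHb v hv).2.trans hHhi.le
  have hpu := hmb u hu
  have hpv := hmb v hv
  have hpt := hmb t ht
  have E1 := est_one hδ0.le hδ1 hx0 hx1 hy0 hy1 (hmlo.le.trans hpu.1) hpu.2 (hmlo.le.trans hpv.1)
    hpv.2 (dist_le m2 κm hmlip u mu v mv) hxy hKd0 hd' hI0.le hIg hZ hZδ
  have W := est_log hδ0 hδ1 hx0 hx1 hy0 hy1 hmlo hpu.1 hpv.1 hpt.1
    (dist_le m2 κm hmlip u mu t mt) (dist_le m2 κm hmlip v mv t mt)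
    (dist_le H κH hHlip u mu t mt) (dist_le H κH hHlip v mv t mt) κH.coe_nonneg hKd0 κm.coe_nonneg hKG hMG
    hd' hI0 hIg hgm0.le (hGb t ht) hI1 hI2
  rw [← hC2] at W
  have E2 := est_two hδ0 (hmlo.trans_le hpu.1) (hmlo.trans_le hpv.1) (hmlo.trans_le hpt.1) hI0
    W hCr
  rw [← hLG t ht, ← hr] at E2
  rw [← hC1] at E1
  have hcov := cov_formula (p := m2 u) (q := m2 v) (x := H u) (y := H v) (hApos u) hA hI0.le hD
  have hcov' : 2 * covATau H L m2 A0 u v = _ := hcov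
  rw [hcov']
  have hp1 : δ ^ 2 ≤ δ ^ (2 * H t + 2 * β) := by
    rw [← Real.rpow_natCast δ 2]
    apply Real.rpow_le_rpow_of_exponent_ge hδ0 hδ1
    push_cast
    linarith [(hHb t ht).2]
  have hp2 : δ ^ (2 * H t) * r ≤ δ ^ (2 * H t + 2 * β) := by
    rw [hr, ← Real.rpow_add hδ0]
    apply Real.rpow_le_rpow_of_exponent_ge hδ0 hδ1
    linarith
  have hL2 : (L t) ^ 2 ≤ Lhi ^ 2 :=
    pow_le_pow_left₀ (hLlo.le.trans (hLb t ht).1) (hLb t ht).2 2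
  have f1 : C1 * δ ^ 2 ≤ C1 * δ ^ (2 * H t + 2 * β) := mul_le_mul_of_nonneg_left hp1 hC10
  have f2 : L t ^ 2 * δ ^ (2 * H t) * (2 * (C2 * r)) ≤
      Lhi ^ 2 * (2 * C2) * δ ^ (2 * H t + 2 * β) := by
    calc L t ^ 2 * δ ^ (2 * H t) * (2 * (C2 * r))
        = L t ^ 2 * (2 * C2) * (δ ^ (2 * H t) * r) := by ring
      _ ≤ Lhi ^ 2 * (2 * C2) * δ ^ (2 * H t + 2 * β) :=
        mul_le_mul (mul_le_mul_of_nonneg_right hL2 (by positivity)) hp2 (by positivity)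
          (by positivity)
  rw [abs_le] at E1 E2 ⊢
  constructor <;> linarith [E1.1, E1.2, E2.1, E2.2]
end
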